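/- arXiv:math/0106231 — 3 statements merged into one kernel-verified Lean document; each statement's English description precedes it below -/
import Mathlib

section
/- Let N = p > 1. Let u : ℝ^N → ℝ be a nonnegative C¹ function satisfying ∫_{ℝ^N} |∇u(x)|^{p−2}⟨∇u(x), ∇φ(x)⟩ dx ≥ 0 for every nonnegative C^∞ compactly supported φ : ℝ^N → ℝ, and set m(r) = inf_{|x| ≤ r} u(x). Then for all 0 < r₁ < r < r₂ one has m(r) ≥ [ m(r₁) log(r/r₂) + m(r₂) log(r₁/r) ] / log(r₁/r₂). -/
open MeasureTheory Metric
open scoped RealInnerProductSpace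

lemma aux_smooth_to_C1 {N : ℕ} (G : EuclideanSpace ℝ (Fin N) → EuclideanSpace ℝ (Fin N))
    (hG : Continuous G)
    (H : ∀ φ : EuclideanSpace ℝ (Fin N) → ℝ,
      ContDiff ℝ (⊤ : ℕ∞) φ → HasCompactSupport φ → (∀ x, 0 ≤ φ x) →
      0 ≤ ∫ x, fderiv ℝ φ x (G x))
    (φ : EuclideanSpace ℝ (Fin N) → ℝ) (h1 : ContDiff ℝ 1 φ) (hc : HasCompactSupport φ)
    (h0 : ∀ x, 0 ≤ φ x) : 0 ≤ ∫ x, fderiv ℝ φ x (G x) := by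
  have hfc : Continuous (fderiv ℝ φ) := h1.continuous_fderiv one_ne_zero
  have hfs : HasCompactSupport (fderiv ℝ φ) := hc.fderiv ℝ
  have huc : UniformContinuous (fderiv ℝ φ) := hfs.uniformContinuous_of_continuous hfc
  obtain ⟨R, hR⟩ := hc.isBounded.subset_closedBall (0 : EuclideanSpace ℝ (Fin N))
  set K := closedBall (0 : EuclideanSpace ℝ (Fin N)) (R + 1) with hK
  have hKc : IsCompact K := isCompact_closedBall _ _
  obtain ⟨C, hC⟩ := hKc.exists_bound_of_continuousOn hG.continuousOn
  have key : ∀ ε > 0, 0 ≤ (∫ x, fderiv ℝ φ x (G x)) + ε * |C| * volume.real K := by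
    intro ε hε
    obtain ⟨δ, hδ, hδ'⟩ := Metric.uniformContinuous_iff.1 huc ε hε
    have hmin : 0 < min δ 1 := lt_min hδ one_pos
    let b : ContDiffBump (0 : EuclideanSpace ℝ (Fin N)) :=
      ⟨min δ 1 / 2, min δ 1, by positivity, by linarith⟩
    have hb : b.rOut = min δ 1 := rfl
    set ψ := convolution (b.normed volume) φ (ContinuousLinearMap.lsmul ℝ ℝ) volume with hψ
    have hφi : LocallyIntegrable φ volume := h1.continuous.locallyIntegrable
    have hbi : LocallyIntegrable (b.normed volume) volume := b.continuous_normed.locallyIntegrable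
    have hψs : ContDiff ℝ (⊤ : ℕ∞) ψ :=
      b.hasCompactSupport_normed.contDiff_convolution_left _ b.contDiff_normed hφi
    have hψsupp : tsupport ψ ⊆ K := by
      refine closure_minimal ?_ isClosed_closedBall
      refine (support_convolution_subset _).trans ?_
      rintro _ ⟨x, hx, y, hy, rfl⟩
      rw [b.support_normed_eq] at hx
      have hy' := hR (subset_tsupport _ hy)
      simp only [hK, mem_closedBall, mem_ball, dist_zero_right] at *
      have := norm_add_le x y
      have := min_le_right δ 1
      rw [hb] at hx
      linarith
    have hψc : HasCompactSupport ψ := hKc.of_isClosed_subset isClosed_closure hψsupp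
    have hψ0 : ∀ x, 0 ≤ ψ x := by
      intro x
      refine integral_nonneg fun t => ?_
      exact mul_nonneg (b.nonneg_normed t) (h0 _)
    have hd : ∀ x, fderiv ℝ ψ x =
        convolution (b.normed volume) (fderiv ℝ φ) (ContinuousLinearMap.lsmul ℝ ℝ) volume x := by
      intro x
      rw [(hc.hasFDerivAt_convolution_right (ContinuousLinearMap.lsmul ℝ ℝ) hbi h1 x).fderiv]
      rfl
    have hdist : ∀ x, ‖fderiv ℝ ψ x - fderiv ℝ φ x‖ ≤ ε := by
      intro x
      rw [hd x, ← dist_eq_norm]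
      refine b.dist_normed_convolution_le hfc.aestronglyMeasurable fun y hy => ?_
      refine (hδ' ?_).le
      exact (mem_ball.1 hy).trans_le (min_le_left _ _)
    have e1 := H ψ hψs hψc hψ0
    have i1 : Integrable (fun x => fderiv ℝ ψ x (G x)) := by
      refine Continuous.integrable_of_hasCompactSupport ?_ ?_
      · exact (hψs.continuous_fderiv (by simp)).clm_apply hG
      · exact (hψc.fderiv ℝ).mono fun x hx => by
          contrapose! hx
          simp [Function.notMem_support.1 hx]
    have i2 : Integrable (fun x => fderiv ℝ φ x (G x)) := by
      refine Continuous.integrable_of_hasCompactSupport ?_ ?_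
      · exact hfc.clm_apply hG
      · exact (hc.fderiv ℝ).mono fun x hx => by
          contrapose! hx
          simp [Function.notMem_support.1 hx]
    have hz : ∀ x, x ∉ K → fderiv ℝ ψ x (G x) - fderiv ℝ φ x (G x) = 0 := by
      intro x hx
      have a1 : fderiv ℝ ψ x = 0 := by
        by_contra h
        exact hx (hψsupp (support_fderiv_subset ℝ h))
      have a2 : fderiv ℝ φ x = 0 := by
        by_contra h
        have := hR (support_fderiv_subset ℝ h)
        exact hx (closedBall_subset_closedBall (by linarith) this)
      simp [a1, a2]
    have e2 : ‖∫ x in K, (fderiv ℝ ψ x (G x) - fderiv ℝ φ x (G x))‖ ≤ ε * |C| * volume.real K := by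
      refine norm_setIntegral_le_of_norm_le_const hKc.measure_lt_top fun x hx => ?_
      rw [← ContinuousLinearMap.sub_apply]
      refine (ContinuousLinearMap.le_opNorm _ _).trans ?_
      exact mul_le_mul (hdist x) ((hC x hx).trans (le_abs_self _)) (norm_nonneg _) hε.le
    rw [setIntegral_eq_integral_of_forall_compl_eq_zero hz, integral_sub i1 i2] at e2
    have := (le_abs_self _).trans e2
    linarith
  refine le_of_forall_pos_le_add fun η hη => ?_
  set D := |C| * volume.real K with hD
  have hD0 : 0 ≤ D := by positivity
  have := key (η / (D + 1)) (by positivity)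
  have h3 : η / (D + 1) * D ≤ η := by
    rw [div_mul_eq_mul_div, div_le_iff₀ (by positivity)]
    nlinarith
  rw [mul_assoc] at this
  linarith

lemma aux_euler {N : ℕ} (h : EuclideanSpace ℝ (Fin N) → ℝ) (h1 : ContDiff ℝ 1 h)
    (hc : HasCompactSupport h) :
    ∫ x, (fderiv ℝ h x x + N * h x) = 0 := by
  have hfc : Continuous (fderiv ℝ h) := h1.continuous_fderiv one_ne_zero
  have ih : Integrable h := h1.continuous.integrable_of_hasCompactSupport hc
  have hi : ∀ i : Fin N, Integrable (fun x : EuclideanSpace ℝ (Fin N) =>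
      x i * fderiv ℝ h x (EuclideanSpace.single i 1)) := by
    intro i
    refine Continuous.integrable_of_hasCompactSupport ?_ ?_
    · exact (by fun_prop : Continuous fun x : EuclideanSpace ℝ (Fin N) => x i).mul
        (hfc.clm_apply continuous_const)
    · exact (hc.fderiv ℝ).mono fun x hx => by
          contrapose! hx
          simp [Function.notMem_support.1 hx]
  have hp : ∀ (i : Fin N) (x v : EuclideanSpace ℝ (Fin N)),
      fderiv ℝ (fun y : EuclideanSpace ℝ (Fin N) => y i) x v = v i := by
    intro i x v
    have : HasFDerivAt (fun y : EuclideanSpace ℝ (Fin N) => y i)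
      (EuclideanSpace.proj i : EuclideanSpace ℝ (Fin N) →L[ℝ] ℝ) x :=
      (EuclideanSpace.proj i : EuclideanSpace ℝ (Fin N) →L[ℝ] ℝ).hasFDerivAt
    rw [this.fderiv]; rfl
  have key : ∀ i : Fin N, ∫ x : EuclideanSpace ℝ (Fin N),
      x i * fderiv ℝ h x (EuclideanSpace.single i 1) = - ∫ x, h x := by
    intro i
    rw [integral_mul_fderiv_eq_neg_fderiv_mul_of_integrable
      (f := fun x : EuclideanSpace ℝ (Fin N) => x i)]
    · simp [hp]
    · simpa [hp] using ih
    · exact hi i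
    · refine Continuous.integrable_of_hasCompactSupport ?_ ?_
      · exact (by fun_prop : Continuous fun x : EuclideanSpace ℝ (Fin N) => x i).mul h1.continuous
      · exact hc.mul_left
    · intro x _; fun_prop
    · intro x _; exact h1.differentiable one_ne_zero x
  have hx : ∀ x, fderiv ℝ h x x = ∑ i, x i * fderiv ℝ h x (EuclideanSpace.single i 1) := by
    intro x
    have : x = ∑ i, x i • EuclideanSpace.single i (1 : ℝ) := by
      ext j; simp [Finset.sum_apply, Pi.single_apply]
    conv_lhs => rw [this, map_sum]
    simp [← this]
  simp_rw [hx]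
  rw [integral_add (integrable_finsetSum _ fun i _ => hi i) (ih.const_mul _),
    integral_finsetSum _ fun i _ => hi i, integral_const_mul]
  simp [key]

lemma aux_mono {E : Type*} [NormedAddCommGroup E] [InnerProductSpace ℝ E] (q : ℕ)
    (a b : E) :
    ‖b‖ ^ q / 2 * ‖b - a‖ ^ 2 ≤ - ⟪‖a‖ ^ q • a - ‖b‖ ^ q • b, b - a⟫ := by
  have h1 : ⟪‖a‖ ^ q • a - ‖b‖ ^ q • b, b - a⟫ =
      ‖a‖ ^ q * (⟪a, b⟫ - ‖a‖ ^ 2) - ‖b‖ ^ q * (‖b‖ ^ 2 - ⟪a, b⟫) := by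
    simp only [inner_sub_left, inner_sub_right, real_inner_smul_left, real_inner_self_eq_norm_sq,
      real_inner_comm a b]
    ring
  have h2 : ‖b - a‖ ^ 2 = ‖b‖ ^ 2 - 2 * ⟪a, b⟫ + ‖a‖ ^ 2 := by
    rw [norm_sub_sq_real, real_inner_comm]
  have h3 : 0 ≤ (‖a‖ ^ q - ‖b‖ ^ q) * (‖a‖ ^ 2 - ‖b‖ ^ 2) := by
    rcases le_total ‖a‖ ‖b‖ with h | h
    · refine mul_nonneg_of_nonpos_of_nonpos ?_ ?_
      · have := pow_le_pow_left₀ (norm_nonneg _) h q; linarith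
      · have := pow_le_pow_left₀ (norm_nonneg _) h 2; linarith
    · refine mul_nonneg ?_ ?_
      · have := pow_le_pow_left₀ (norm_nonneg _) h q; linarith
      · have := pow_le_pow_left₀ (norm_nonneg _) h 2; linarith
  have h4 : 0 ≤ ‖a‖ ^ q * ‖b - a‖ ^ 2 := by positivity
  rw [h1]
  rw [h2] at *
  nlinarith

lemma aux_compare {n : ℕ} (u : EuclideanSpace ℝ (Fin (n + 2)) → ℝ) (hu : ContDiff ℝ 1 u)
    (hgc : Continuous (gradient u))
    (H : ∀ φ : EuclideanSpace ℝ (Fin (n + 2)) → ℝ,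
      ContDiff ℝ 1 φ → HasCompactSupport φ → (∀ x, 0 ≤ φ x) →
      0 ≤ ∫ x, fderiv ℝ φ x (‖gradient u x‖ ^ n • gradient u x))
    (c M r₁ r₂ : ℝ) (hc : 0 < c) (hr₁ : 0 < r₁)
    (hb1 : ∀ x, ‖x‖ = r₁ → M - c * Real.log ‖x‖ ≤ u x)
    (hb2 : ∀ x, ‖x‖ = r₂ → M - c * Real.log ‖x‖ ≤ u x) :
    ∀ x, r₁ ≤ ‖x‖ → ‖x‖ ≤ r₂ → M - c * Real.log ‖x‖ ≤ u x := by
  classical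
  intro x₀ hx₁ hx₂
  by_contra hlt
  push Not at hlt
  set w : EuclideanSpace ℝ (Fin (n + 2)) → ℝ := fun x => M - c * Real.log ‖x‖ - u x with hw
  have hw0 : 0 < w x₀ := by simp only [hw]; linarith
  set ε := w x₀ / 2 with hε
  have hε0 : 0 < ε := by positivity
  have hεw : ε < w x₀ := by linarith
  -- derivative of w
  set b : EuclideanSpace ℝ (Fin (n + 2)) → EuclideanSpace ℝ (Fin (n + 2)) :=
    fun x => (-(c / ‖x‖ ^ 2)) • x with hb
  have hwd : ∀ x, x ≠ 0 → HasFDerivAt w (innerSL ℝ (b x - gradient u x)) x := by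
    intro x hx
    have hx' : ‖x‖ ^ 2 ≠ 0 := by positivity
    have e1 := ((hasStrictFDerivAt_norm_sq x).hasFDerivAt.log hx').const_mul (c / 2)
    have e2 := ((hu.differentiable one_ne_zero x).hasGradientAt).hasFDerivAt
    have e3 := (e1.const_sub M).sub e2
    refine (e3.congr_fderiv ?_).congr_of_eventuallyEq (Filter.Eventually.of_forall fun y => ?_)
    · ext y
      simp [hb, inner_sub_left, real_inner_smul_left]
      ring
    · simp only [hw, Real.log_pow, Pi.sub_apply]
      push_cast
      ring
  have hwc : ∀ x, x ≠ 0 → ContDiffAt ℝ 1 w x := by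
    intro x hx
    have := (contDiffAt_norm ℝ hx (n := 1)).log (norm_ne_zero_iff.2 hx)
    exact ((contDiffAt_const).sub (contDiffAt_const.mul this)).sub hu.contDiffAt
  have hwcont : ContinuousOn w {x | r₁ ≤ ‖x‖ ∧ ‖x‖ ≤ r₂} := by
    intro x hx
    have : x ≠ 0 := norm_pos_iff.1 (hr₁.trans_le hx.1)
    exact (hwc x this).continuousAt.continuousWithinAt
  set η : ℝ → ℝ := fun t => expNegInvGlue (t - ε) with hη
  have hηs : ContDiff ℝ 1 η :=
    (expNegInvGlue.contDiff (n := 1)).comp (contDiff_id.sub contDiff_const)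
  have hηm : Monotone η := fun s t hst => expNegInvGlue.monotone (by linarith)
  set A : Set (EuclideanSpace ℝ (Fin (n + 2))) := {x | r₁ < ‖x‖ ∧ ‖x‖ < r₂} with hA
  have hAo : IsOpen A :=
    (isOpen_lt continuous_const continuous_norm).inter (isOpen_lt continuous_norm continuous_const)
  set φ : EuclideanSpace ℝ (Fin (n + 2)) → ℝ := fun x => if x ∈ A then η (w x) else 0 with hφ
  set K : Set (EuclideanSpace ℝ (Fin (n + 2))) :=
    {x | r₁ ≤ ‖x‖ ∧ ‖x‖ ≤ r₂} ∩ w ⁻¹' Set.Ici ε with hK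
  have hKcl : IsClosed K := by
    refine hwcont.preimage_isClosed_of_isClosed ?_ isClosed_Ici
    exact (isClosed_le continuous_const continuous_norm).inter
      (isClosed_le continuous_norm continuous_const)
  have hKA : K ⊆ A := by
    rintro x ⟨⟨h1, h2⟩, h3⟩
    have h3' : ε ≤ w x := h3
    refine ⟨lt_of_le_of_ne h1 fun h => ?_, lt_of_le_of_ne h2 fun h => ?_⟩
    · have := hb1 x h.symm
      simp only [hw] at h3'
      linarith
    · have := hb2 x h
      simp only [hw] at h3'
      linarith
  have hKc : IsCompact K := by
    refine (isCompact_closedBall (0 : EuclideanSpace ℝ (Fin (n + 2))) r₂).of_isClosed_subset hKcl ?_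
    rintro x ⟨⟨h1, h2⟩, h3⟩
    simpa using h2
  have hA0 : ∀ x ∈ A, x ≠ 0 := fun x hx => norm_pos_iff.1 (hr₁.trans hx.1)
  have hφ0 : ∀ x, x ∉ K → φ x = 0 := by
    intro x hx
    by_cases hxA : x ∈ A
    · have : w x < ε := by
        by_contra h
        exact hx ⟨⟨hxA.1.le, hxA.2.le⟩, not_lt.1 h⟩
      simp only [hφ, hxA, if_true, hη]
      exact expNegInvGlue.zero_of_nonpos (by linarith)
    · simp [hφ, hxA]
  have hφe0 : ∀ x, x ∉ K → φ =ᶠ[nhds x] fun _ => 0 := by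
    intro x hx
    filter_upwards [hKcl.isOpen_compl.mem_nhds hx] with y hy using hφ0 y hy
  have hφeA : ∀ x ∈ A, φ =ᶠ[nhds x] fun y => η (w y) := by
    intro x hx
    filter_upwards [hAo.mem_nhds hx] with y hy
    simp [hφ, hy]
  have hφc1 : ContDiff ℝ 1 φ := by
    rw [contDiff_iff_contDiffAt]
    intro x
    by_cases hx : x ∈ K
    · exact (hηs.contDiffAt.comp x (hwc x (hA0 x (hKA hx)))).congr_of_eventuallyEq
        (hφeA x (hKA hx))
    · exact contDiffAt_const.congr_of_eventuallyEq (hφe0 x hx)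
  have hφcs : HasCompactSupport φ :=
    HasCompactSupport.intro hKc hφ0
  have hφnn : ∀ x, 0 ≤ φ x := by
    intro x
    simp only [hφ]
    split_ifs
    · exact expNegInvGlue.nonneg _
    · exact le_rfl
  have hfA : ∀ x ∈ A, fderiv ℝ φ x = deriv η (w x) • innerSL ℝ (b x - gradient u x) := by
    intro x hx
    rw [(hφeA x hx).fderiv_eq]
    exact ((hηs.differentiable one_ne_zero (w x)).hasDerivAt.comp_hasFDerivAt x
      (hwd x (hA0 x hx))).fderiv
  have hf0 : ∀ x, x ∉ K → fderiv ℝ φ x = 0 := by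
    intro x hx
    rw [(hφe0 x hx).fderiv_eq]; simp
  -- the radial test
  set h : EuclideanSpace ℝ (Fin (n + 2)) → ℝ := fun x => (‖x‖ ^ (n + 2))⁻¹ * φ x with hh
  have h0K : (0 : EuclideanSpace ℝ (Fin (n + 2))) ∉ K := fun h => hA0 _ (hKA h) rfl
  have hhc1 : ContDiff ℝ 1 h := by
    rw [contDiff_iff_contDiffAt]
    intro x
    by_cases hx : x = 0
    · have : h =ᶠ[nhds x] fun _ => 0 := by
        filter_upwards [hφe0 x (hx ▸ h0K)] with y hy
        simp [hh, hy]
      exact contDiffAt_const.congr_of_eventuallyEq this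
    · have := ((contDiffAt_norm ℝ hx (n := 1)).pow (n + 2)).inv (by positivity)
      exact this.mul hφc1.contDiffAt
  have hhcs : HasCompactSupport h := hφcs.mul_left
  have hhd : ∀ x, fderiv ℝ h x x + ((n + 2 : ℕ) : ℝ) * h x
      = (‖x‖ ^ (n + 2))⁻¹ * fderiv ℝ φ x x := by
    intro x
    by_cases hx : x = 0
    · subst hx
      simp [hh, hφ0 _ h0K]
    · have hx' : ‖x‖ ≠ 0 := norm_ne_zero_iff.2 hx
      have hd : DifferentiableAt ℝ (fun y : EuclideanSpace ℝ (Fin (n + 2)) => ‖y‖) x :=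
        (contDiffAt_norm ℝ hx (n := 1)).differentiableAt one_ne_zero
      have e1 := ((hasDerivAt_pow (n + 2) ‖x‖).fun_inv (pow_ne_zero _ hx')).comp_hasFDerivAt x
        hd.hasFDerivAt
      have e2 := e1.mul (hφc1.differentiable one_ne_zero x).hasFDerivAt
      have e3 : fderiv ℝ h x = _ := e2.fderiv
      rw [e3]
      have e4 : fderiv ℝ (fun y : EuclideanSpace ℝ (Fin (n + 2)) => ‖y‖) x x = ‖x‖ := by
        have q1 := ((hasDerivAt_pow 2 ‖x‖).comp_hasFDerivAt x hd.hasFDerivAt).unique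
          (hasStrictFDerivAt_norm_sq x).hasFDerivAt
        have q2 := DFunLike.congr_fun q1 x
        simp at q2
        have q3 : ‖x‖ * fderiv ℝ (fun y : EuclideanSpace ℝ (Fin (n + 2)) => ‖y‖) x x
            = ‖x‖ * ‖x‖ := by linarith
        exact mul_left_cancel₀ hx' q3
      simp [e4, hh]
      field_simp
      ring
  have E0 := aux_euler h hhc1 hhcs
  have Ei : Integrable (fun x => fderiv ℝ h x x + ((n + 2 : ℕ) : ℝ) * h x) := by
    refine Continuous.integrable_of_hasCompactSupport ?_ ?_
    · exact ((hhc1.continuous_fderiv one_ne_zero).clm_apply continuous_id).add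
        (continuous_const.mul hhc1.continuous)
    · refine HasCompactSupport.add ?_ hhcs.mul_left
      exact (hhcs.fderiv ℝ).mono fun x hx => by
          contrapose! hx
          simp [Function.notMem_support.1 hx]
  simp_rw [hhd] at E0 Ei
  have H1 := H φ hφc1 hφcs hφnn
  have Hi : Integrable (fun x => fderiv ℝ φ x (‖gradient u x‖ ^ n • gradient u x)) := by
    refine Continuous.integrable_of_hasCompactSupport ?_ ?_
    · exact (hφc1.continuous_fderiv one_ne_zero).clm_apply ((hgc.norm.pow n).smul hgc)
    · exact (hφcs.fderiv ℝ).mono fun x hx => by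
          contrapose! hx
          simp [Function.notMem_support.1 hx]
  set J : EuclideanSpace ℝ (Fin (n + 2)) → ℝ := fun x =>
    -(fderiv ℝ φ x (‖gradient u x‖ ^ n • gradient u x) +
      c ^ (n + 1) * ((‖x‖ ^ (n + 2))⁻¹ * fderiv ℝ φ x x)) with hJ
  have hJi : Integrable J := (Hi.add (Ei.const_mul _)).neg
  have hJint : ∫ x, J x ≤ 0 := by
    simp only [hJ]
    rw [integral_neg, integral_add Hi (Ei.const_mul _), integral_const_mul, E0]
    linarith
  have hJA : ∀ x ∈ A, deriv η (w x) * (‖b x‖ ^ n / 2 * ‖b x - gradient u x‖ ^ 2) ≤ J x := by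
    intro x hx
    have hx' : ‖x‖ ≠ 0 := norm_ne_zero_iff.2 (hA0 x hx)
    have hbn : ‖b x‖ = c / ‖x‖ := by
      simp only [hb, norm_smul, norm_neg, norm_div, norm_pow, norm_norm, Real.norm_of_nonneg hc.le]
      field_simp
    have hbb : ‖b x‖ ^ n • b x = -(c ^ (n + 1) * (‖x‖ ^ (n + 2))⁻¹) • x := by
      rw [hbn]
      simp only [hb, smul_smul]
      congr 1
      rw [div_pow]
      field_simp
      ring
    have hJx : J x = deriv η (w x) *
        -⟪‖gradient u x‖ ^ n • gradient u x - ‖b x‖ ^ n • b x, b x - gradient u x⟫ := by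
      simp only [hJ, hfA x hx, hbb]
      simp only [_root_.smul_apply, innerSL_apply_apply, smul_eq_mul, map_smul,
        inner_sub_left, inner_sub_right, real_inner_smul_left, real_inner_smul_right]
      rw [real_inner_comm x (b x), real_inner_comm x (gradient u x),
        real_inner_comm (gradient u x) (b x)]
      ring
    rw [hJx]
    exact mul_le_mul_of_nonneg_left (aux_mono n _ _) hηm.deriv_nonneg
  have hJnn : ∀ x, 0 ≤ J x := by
    intro x
    by_cases hx : x ∈ A
    · refine le_trans ?_ (hJA x hx)
      exact mul_nonneg hηm.deriv_nonneg (by positivity)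
    · simp [hJ, hf0 x fun h => hx (hKA h)]
  have hJ0 : J =ᵐ[volume] 0 :=
    (integral_eq_zero_iff_of_nonneg hJnn hJi).1 (le_antisymm hJint (integral_nonneg hJnn))
  have hfae : fderiv ℝ φ =ᵐ[volume] fun _ => 0 := by
    filter_upwards [hJ0] with x hx
    by_cases hxA : x ∈ A
    · have e := hJA x hxA
      rw [hx] at e
      have hx' : 0 < ‖x‖ := norm_pos_iff.2 (hA0 x hxA)
      have hbn : 0 < ‖b x‖ := by
        rw [norm_pos_iff]
        exact smul_ne_zero (by simp [hc.ne', hA0 x hxA]) (hA0 x hxA)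
      have e' : deriv η (w x) * (‖b x‖ ^ n / 2 * ‖b x - gradient u x‖ ^ 2) = 0 :=
        le_antisymm e (mul_nonneg hηm.deriv_nonneg (by positivity))
      rw [hfA x hxA]
      rcases mul_eq_zero.1 e' with h | h
      · simp [h]
      · rcases mul_eq_zero.1 h with h | h
        · exact absurd h (by positivity)
        · have : b x - gradient u x = 0 := by simpa using h
          simp [this]
    · exact hf0 x fun h => hxA (hKA h)
  have hfz : fderiv ℝ φ = fun _ => 0 :=
    ((hφc1.continuous_fderiv one_ne_zero).ae_eq_iff_eq volume continuous_const).1 hfae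
  have hconst := is_const_of_fderiv_eq_zero (𝕜 := ℝ) (hφc1.differentiable one_ne_zero)
    (fun x => congrFun hfz x) x₀ 0
  rw [hφ0 0 h0K] at hconst
  have hxK : x₀ ∈ K := ⟨⟨hx₁, hx₂⟩, hεw.le⟩
  simp only [hφ, hKA hxK, if_true, hη, expNegInvGlue.zero_iff_nonpos] at hconst
  linarith

/-- Hadamard three-spheres type inequality for p-superharmonic functions, case `N = p`. -/
theorem hadamard_inequality_eq
    (N : ℕ) (p : ℝ) (hp : 1 < p) (hNp : (N : ℝ) = p)
    (u : EuclideanSpace ℝ (Fin N) → ℝ)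
    (hu : ContDiff ℝ 1 u) (hu_nonneg : ∀ x, 0 ≤ u x)
    (hsuper : ∀ φ : EuclideanSpace ℝ (Fin N) → ℝ,
      ContDiff ℝ (⊤ : ℕ∞) φ → HasCompactSupport φ → (∀ x, 0 ≤ φ x) →
      0 ≤ ∫ x, ‖gradient u x‖ ^ (p - 2) * ⟪gradient u x, gradient φ x⟫)
    (m : ℝ → ℝ)
    (hm : ∀ r : ℝ, m r = sInf (u '' closedBall (0 : EuclideanSpace ℝ (Fin N)) r)) :
    ∀ r₁ r r₂ : ℝ, 0 < r₁ → r₁ < r → r < r₂ →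
      (m r₁ * Real.log (r / r₂) + m r₂ * Real.log (r₁ / r)) /
          Real.log (r₁ / r₂) ≤ m r := by
  intro r₁ r r₂ h1 h2 h3
  subst hNp
  have hN : 2 ≤ N := by exact_mod_cast hp
  obtain ⟨n, rfl⟩ := Nat.exists_eq_add_of_le' hN
  have hgc : Continuous (gradient u) :=
    (LinearIsometryEquiv.continuous _).comp (hu.continuous_fderiv one_ne_zero)
  have H := aux_smooth_to_C1 (fun x => ‖gradient u x‖ ^ n • gradient u x)
    ((hgc.norm.pow n).smul hgc) (by
      intro φ hφ hφc hφ0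
      refine (hsuper φ hφ hφc hφ0).trans_eq (integral_congr_ae (Filter.Eventually.of_forall ?_))
      intro x
      have e : (((n + 2 : ℕ) : ℝ) - 2) = (n : ℝ) := by push_cast; ring
      have e2 := (((hφ.differentiable (by simp)) x).hasGradientAt).hasFDerivAt.fderiv
      simp only [e, Real.rpow_natCast, e2, map_smul, smul_eq_mul]
      rw [real_inner_comm, InnerProductSpace.toDual_apply_apply])
  have hle : ∀ s x, ‖x‖ ≤ s → m s ≤ u x := by
    intro s x hx
    rw [hm]
    refine csInf_le ⟨0, ?_⟩ ⟨x, by simpa using hx, rfl⟩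
    rintro _ ⟨y, _, rfl⟩
    exact hu_nonneg y
  have hge : ∀ s a, 0 < s → (∀ x, ‖x‖ ≤ s → a ≤ u x) → a ≤ m s := by
    intro s a hs ha
    rw [hm]
    refine le_csInf ⟨_, 0, by simpa using hs.le, rfl⟩ ?_
    rintro _ ⟨y, hy, rfl⟩
    exact ha y (by simpa using hy)
  have hr : 0 < r := h1.trans h2
  have hr₂ : 0 < r₂ := hr.trans h3
  have hL1 : Real.log r₁ < Real.log r := Real.log_lt_log h1 h2
  have hL2 : Real.log r < Real.log r₂ := Real.log_lt_log hr h3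
  have hmm : m r₂ ≤ m r₁ := hge r₁ _ h1 fun x hx => hle r₂ x (by linarith)
  rw [Real.log_div hr.ne' hr₂.ne', Real.log_div h1.ne' hr.ne', Real.log_div h1.ne' hr₂.ne']
  set l₁ := Real.log r₁
  set l := Real.log r with hl
  set l₂ := Real.log r₂
  have hd : l₂ - l₁ ≠ 0 := by linarith
  have hd' : l₁ - l₂ ≠ 0 := by linarith
  rcases hmm.eq_or_lt with heq | hlt
  · have : (m r₁ * (l - l₂) + m r₂ * (l₁ - l)) / (l₁ - l₂) = m r₂ := by
      rw [← heq]; field_simp; ring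
    rw [this]
    exact hge r _ hr fun x hx => hle r₂ x (by linarith)
  · set c := (m r₁ - m r₂) / (l₂ - l₁) with hc
    have hc0 : 0 < c := div_pos (by linarith) (by linarith)
    have hcm : c * (l₂ - l₁) = m r₁ - m r₂ := by rw [hc]; field_simp
    have hval : (m r₁ * (l - l₂) + m r₂ * (l₁ - l)) / (l₁ - l₂) = m r₁ + c * l₁ - c * l := by
      rw [div_eq_iff hd']
      linear_combination (l₁ - l) * hcm
    rw [hval]
    have hcmp := aux_compare u hu hgc H c (m r₁ + c * l₁) r₁ r₂ hc0 h1
      (fun x hx => by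
        have := hle r₁ x hx.le
        rw [hx]; linarith)
      (fun x hx => by
        have := hle r₂ x hx.le
        rw [hx]; linarith)
    refine hge r _ hr fun x hx => ?_
    rcases le_total ‖x‖ r₁ with hx1 | hx1
    · have := hle r₁ x hx1
      have : c * l₁ ≤ c * l := mul_le_mul_of_nonneg_left hL1.le hc0.le
      linarith
    · refine le_trans ?_ (hcmp x hx1 (by linarith))
      have : Real.log ‖x‖ ≤ l := Real.log_le_log (by linarith) hx
      have := mul_le_mul_of_nonneg_left this hc0.le
      linarith
end

section
/- Let 1 < p < N and set λ = (p−N)/(p−1) (so λ < 0). Let u : ℝ^N → ℝ be a nonnegative C¹ function satisfying ∫_{ℝ^N} |∇u(x)|^{p−2}⟨∇u(x), ∇φ(x)⟩ dx ≥ 0 for every nonnegative C^∞ compactly supported φ : ℝ^N → ℝ, and set m(r) = inf_{|x| ≤ r} u(x). Then for all 0 < r₁ ≤ r one has m(r) ≥ m(r₁) · (r/r₁)^λ; equivalently, the function r ↦ m(r) r^{−λ} is nondecreasing on (0, ∞). -/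
open MeasureTheory Metric
open scoped RealInnerProductSpace

namespace Hadamard
open Filter Topology

/-- The vector field `|a|^{p-2} a`. -/
noncomputable def A {E : Type*} [NormedAddCommGroup E] [InnerProductSpace ℝ E] (p : ℝ) (a : E) : E :=
  ‖a‖ ^ (p - 2) • a

section alg
variable {E : Type*} [NormedAddCommGroup E] [InnerProductSpace ℝ E] {p : ℝ}

lemma rpow_mul_self (hp : 1 < p) {s : ℝ} (hs : 0 ≤ s) : s ^ (p - 2) * s = s ^ (p - 1) := by
  rcases hs.eq_or_lt with h | h
  · rw [← h, Real.zero_rpow (by linarith : p - 1 ≠ 0), mul_zero]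
  · rw [← Real.rpow_add_one h.ne']; congr 1; ring

lemma norm_A (hp : 1 < p) (a : E) : ‖A p a‖ = ‖a‖ ^ (p - 1) := by
  rw [A, norm_smul, Real.norm_of_nonneg (by positivity), rpow_mul_self hp (norm_nonneg a)]

lemma continuous_A (hp : 1 < p) : Continuous (A p : E → E) := by
  rw [continuous_iff_continuousAt]
  intro a
  by_cases ha : a = 0
  · subst ha
    have h0 : A p (0 : E) = 0 := by simp [A]
    rw [ContinuousAt, h0, tendsto_zero_iff_norm_tendsto_zero]
    have : Continuous fun a : E => ‖a‖ ^ (p - 1) :=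
      continuous_norm.rpow_const (fun _ => Or.inr (by linarith))
    have h := this.tendsto 0
    simp only [norm_zero, Real.zero_rpow (by linarith : p - 1 ≠ 0)] at h
    simpa only [norm_A hp] using h
  · exact (continuous_norm.continuousAt.rpow_const (Or.inl (norm_ne_zero_iff.2 ha))).smul
      continuousAt_id

lemma inner_A_ge (hp : 1 < p) (a b : E) :
    (‖a‖ ^ (p - 1) - ‖b‖ ^ (p - 1)) * (‖a‖ - ‖b‖) ≤ ⟪A p a - A p b, a - b⟫ := by
  have h1 := real_inner_le_norm a b
  have ha := rpow_mul_self hp (norm_nonneg a)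
  have hb := rpow_mul_self hp (norm_nonneg b)
  have ha0 : 0 ≤ ‖a‖ ^ (p - 2) := by positivity
  have hb0 : 0 ≤ ‖b‖ ^ (p - 2) := by positivity
  simp only [A, inner_sub_left, inner_sub_right, real_inner_smul_left,
    real_inner_self_eq_norm_sq, real_inner_comm a b] at *
  rw [← ha, ← hb]
  nlinarith [mul_le_mul_of_nonneg_left h1 ha0, mul_le_mul_of_nonneg_left h1 hb0]

lemma mono_nonneg (hp : 1 < p) {s t : ℝ} (hs : 0 ≤ s) (ht : 0 ≤ t) :
    0 ≤ (s ^ (p - 1) - t ^ (p - 1)) * (s - t) := by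
  rcases le_total s t with h | h
  · have := Real.rpow_le_rpow hs h (by linarith : 0 ≤ p - 1)
    nlinarith
  · have := Real.rpow_le_rpow ht h (by linarith : 0 ≤ p - 1)
    nlinarith

lemma inner_A_nonneg (hp : 1 < p) (a b : E) : 0 ≤ ⟪A p a - A p b, a - b⟫ :=
  (mono_nonneg hp (norm_nonneg a) (norm_nonneg b)).trans (inner_A_ge hp a b)

lemma eq_of_inner_A (hp : 1 < p) {a b : E} (h : ⟪A p a - A p b, a - b⟫ = 0) : a = b := by
  have h1 := inner_A_ge hp a b
  rw [h] at h1
  have h2 := le_antisymm h1 (mono_nonneg hp (norm_nonneg a) (norm_nonneg b))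
  have hn : ‖a‖ = ‖b‖ := by
    rcases mul_eq_zero.1 h2 with h3 | h3
    · exact (Real.rpow_left_inj (norm_nonneg a) (norm_nonneg b) (by linarith : p - 1 ≠ 0)).1
        (by linarith)
    · linarith
  by_cases ha : ‖a‖ = 0
  · rw [norm_eq_zero.1 ha, norm_eq_zero.1 (hn.symm.trans ha)]
  · have hA : A p a - A p b = ‖a‖ ^ (p - 2) • (a - b) := by
      rw [A, A, ← hn, smul_sub]
    rw [hA, real_inner_smul_left] at h
    have hpos : 0 < ‖a‖ ^ (p - 2) :=
      Real.rpow_pos_of_pos (lt_of_le_of_ne (norm_nonneg a) (Ne.symm ha)) _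
    have := (mul_eq_zero.1 h).resolve_left hpos.ne'
    exact sub_eq_zero.1 (inner_self_eq_zero.1 this)
end alg

variable {N : ℕ}

lemma integrable_of_bdd {E' : Type*} [NormedAddCommGroup E']
    {f : EuclideanSpace ℝ (Fin N) → E'} (hf : AEStronglyMeasurable f volume)
    {C R : ℝ} (hC : ∀ x, ‖f x‖ ≤ C) (hR : ∀ x, R < ‖x‖ → f x = 0) : Integrable f volume := by
  have : Integrable ((closedBall (0 : EuclideanSpace ℝ (Fin N)) R).indicator f) volume := by
    rw [integrable_indicator_iff measurableSet_closedBall]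
    exact Measure.integrableOn_of_bounded (M := C) measure_closedBall_lt_top.ne hf
      (Eventually.of_forall hC)
  convert this using 1
  symm
  rw [Set.indicator_eq_self]
  intro x hx
  by_contra h
  exact hx (hR x (by simpa using h))

lemma zero_outside {E' : Type*} [NormedAddCommGroup E']
    {f : EuclideanSpace ℝ (Fin N) → E'} (hf : HasCompactSupport f) :
    ∃ R, 0 < R ∧ ∀ x, R < ‖x‖ → f x = 0 := by
  obtain ⟨R, h0, hR⟩ := hf.isCompact.isBounded.subset_closedBall_lt 0 0
  refine ⟨R, h0, fun x hx => image_eq_zero_of_notMem_tsupport fun h => ?_⟩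
  have := hR h
  simp at this
  linarith

open ContinuousLinearMap in
open scoped Convolution in
lemma mollify {F : EuclideanSpace ℝ (Fin N) → EuclideanSpace ℝ (Fin N)} (hF : Continuous F)
    (h : ∀ φ : EuclideanSpace ℝ (Fin N) → ℝ,
      ContDiff ℝ (⊤ : ℕ∞) φ → HasCompactSupport φ → (∀ x, 0 ≤ φ x) →
      0 ≤ ∫ x, fderiv ℝ φ x (F x))
    {w : EuclideanSpace ℝ (Fin N) → ℝ} (hw : ContDiff ℝ 1 w) (hc : HasCompactSupport w)
    (h0 : ∀ x, 0 ≤ w x) : 0 ≤ ∫ x, fderiv ℝ w x (F x) := by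
  obtain ⟨R, hR0, hR⟩ := zero_outside hc
  have hg : Continuous (fderiv ℝ w) := hw.continuous_fderiv one_ne_zero
  obtain ⟨C, hC⟩ := (hc.fderiv ℝ).exists_bound_of_continuous hg
  have hC0 : 0 ≤ C := (norm_nonneg _).trans (hC 0)
  let ρ : ℕ → ContDiffBump (0 : EuclideanSpace ℝ (Fin N)) := fun n =>
    ⟨1 / (2 * ((n : ℝ) + 1)), 1 / ((n : ℝ) + 1), by positivity, by
      apply one_div_lt_one_div_of_lt <;> linarith [(Nat.cast_nonneg n : (0 : ℝ) ≤ n)]⟩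
  have hρ : Tendsto (fun n => (ρ n).rOut) atTop (𝓝 0) := tendsto_one_div_add_atTop_nhds_zero_nat
  have hρ1 : ∀ n, (ρ n).rOut ≤ 1 := fun n => by
    show 1 / ((n : ℝ) + 1) ≤ 1
    rw [div_le_one (by positivity)]
    linarith [(Nat.cast_nonneg n : (0 : ℝ) ≤ n)]
  let φ : ℕ → EuclideanSpace ℝ (Fin N) → ℝ := fun n =>
    ((ρ n).normed volume ⋆[lsmul ℝ ℝ, volume] w)
  let ψ : ℕ → EuclideanSpace ℝ (Fin N) → (EuclideanSpace ℝ (Fin N) →L[ℝ] ℝ) := fun n =>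
    ((ρ n).normed volume ⋆[lsmul ℝ ℝ, volume] (fderiv ℝ w))
  have hρl : ∀ n, LocallyIntegrable ((ρ n).normed volume) volume := fun n =>
    ((ρ n).continuous_normed).locallyIntegrable
  have hφd : ∀ n x, fderiv ℝ (φ n) x = ψ n x := fun n x => by
    rw [(hc.hasFDerivAt_convolution_right (lsmul ℝ ℝ) (hρl n) hw x).fderiv]
    rfl
  have hφs : ∀ n, ContDiff ℝ (⊤ : ℕ∞) (φ n) := fun n =>
    (ρ n).hasCompactSupport_normed.contDiff_convolution_left _ (ρ n).contDiff_normed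
      hw.continuous.locallyIntegrable
  have hφc : ∀ n, HasCompactSupport (φ n) := fun n =>
    (ρ n).hasCompactSupport_normed.convolution _ hc
  have hφ0 : ∀ n x, 0 ≤ φ n x := fun n x =>
    integral_nonneg fun t => mul_nonneg ((ρ n).nonneg_normed t) (h0 _)
  have hsupp : ∀ n x, R + 2 < ‖x‖ → φ n x = 0 := fun n x hx => by
    by_contra hne
    obtain ⟨a, ha, b, hb, hab⟩ := support_convolution_subset_swap (lsmul ℝ ℝ) hne
    have h1 : ‖a‖ ≤ R := by
      by_contra hlt
      exact ha (hR a (not_le.1 hlt))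
    rw [(ρ n).support_normed_eq] at hb
    have h2 : ‖b‖ < (ρ n).rOut := by simpa using hb
    have h3 := norm_add_le a b
    have h4 : a + b = x := hab
    rw [h4] at h3
    linarith [hρ1 n]
  have hψ0 : ∀ n x, R + 2 < ‖x‖ → ψ n x = 0 := fun n x hx => by
    rw [← hφd]
    have : φ n =ᶠ[𝓝 x] fun _ => 0 := by
      filter_upwards [(isOpen_lt continuous_const continuous_norm).mem_nhds hx] with y hy
      exact hsupp n y hy
    rw [this.fderiv_eq]; simp
  have hψb : ∀ n x, ‖ψ n x‖ ≤ 3 * C := fun n x => by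
    have hd : dist (ψ n x) (fderiv ℝ w x) ≤ 2 * C :=
      (ρ n).dist_normed_convolution_le hg.aestronglyMeasurable fun y _ => by
        rw [dist_eq_norm]
        linarith [norm_sub_le (fderiv ℝ w y) (fderiv ℝ w x), hC x, hC y]
    rw [dist_eq_norm] at hd
    have := norm_le_norm_add_norm_sub' (ψ n x) (fderiv ℝ w x)
    linarith [hC x]
  have hlim : Tendsto (fun n => ∫ x, fderiv ℝ (φ n) x (F x)) atTop
      (𝓝 (∫ x, fderiv ℝ w x (F x))) := by
    refine tendsto_integral_of_dominated_convergence
      ((closedBall (0 : EuclideanSpace ℝ (Fin N)) (R + 2)).indicator fun x => 3 * C * ‖F x‖)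
      (fun n => ?_) ?_ (fun n => ?_) ?_
    · exact ((((hφs n).continuous_fderiv (by simp)).clm_apply hF)).aestronglyMeasurable
    · rw [integrable_indicator_iff measurableSet_closedBall]
      exact (continuous_const.mul hF.norm).continuousOn.integrableOn_compact
        (isCompact_closedBall _ _)
    · refine Eventually.of_forall fun x => ?_
      rw [hφd]
      by_cases hx : x ∈ closedBall (0 : EuclideanSpace ℝ (Fin N)) (R + 2)
      · rw [Set.indicator_of_mem hx]
        exact (le_opNorm _ _).trans (mul_le_mul_of_nonneg_right (hψb n x) (norm_nonneg _))
      · rw [Set.indicator_of_notMem hx, hψ0 n x (by simpa using hx)]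
        simp
    · refine Eventually.of_forall fun x => ?_
      simp only [hφd]
      have := ContDiffBump.convolution_tendsto_right_of_continuous (μ := volume) hρ hg x
      exact ((ContinuousLinearMap.apply ℝ ℝ (F x)).continuous.tendsto _).comp this
  exact ge_of_tendsto' hlim fun n => h _ (hφs n) (hφc n) (hφ0 n)

lemma scaling {w : EuclideanSpace ℝ (Fin N) → ℝ} (hw : ContDiff ℝ 1 w) (hc : HasCompactSupport w)
    {r : ℝ} (hr : 0 < r) (h0 : ∀ x, ‖x‖ < r → w x = 0) :
    Integrable (fun x => (‖x‖ ^ N)⁻¹ * fderiv ℝ w x x) ∧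
    ∫ x, (‖x‖ ^ N)⁻¹ * fderiv ℝ w x x = 0 := by
  obtain ⟨R, hR0, hR⟩ := zero_outside hc
  have hg : Continuous (fderiv ℝ w) := hw.continuous_fderiv one_ne_zero
  obtain ⟨R', hR0', hR'⟩ := zero_outside (hc.fderiv ℝ)
  obtain ⟨C, hC⟩ := (hc.fderiv ℝ).exists_bound_of_continuous hg
  obtain ⟨D, hD⟩ := hc.exists_bound_of_continuous hw.continuous
  have hC0 : 0 ≤ C := (norm_nonneg _).trans (hC 0)
  have hD0 : 0 ≤ D := (norm_nonneg _).trans (hD 0)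
  have hg0 : ∀ x, ‖x‖ < r → fderiv ℝ w x = 0 := fun x hx => by
    have : w =ᶠ[𝓝 x] fun _ => 0 := by
      filter_upwards [(isOpen_lt continuous_norm continuous_const).mem_nhds hx] with y hy
      exact h0 y hy
    rw [this.fderiv_eq]; simp
  have hmeas : Measurable fun x : EuclideanSpace ℝ (Fin N) => (‖x‖ ^ N)⁻¹ := by fun_prop
  have hq : ∀ {s : ℝ}, 0 < s → ∀ x : EuclideanSpace ℝ (Fin N), s ≤ ‖x‖ →
      ‖(‖x‖ ^ N)⁻¹‖ ≤ (s ^ N)⁻¹ := fun {s} hs x hx => by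
    rw [Real.norm_of_nonneg (by positivity)]
    gcongr
  let B : EuclideanSpace ℝ (Fin N) → ℝ :=
    (closedBall (0 : EuclideanSpace ℝ (Fin N)) (2 * R')).indicator
      fun _ => ((r / 2) ^ N)⁻¹ * (C * (2 * R'))
  have hB0 : ∀ x, 0 ≤ B x := fun x => Set.indicator_nonneg (fun _ _ => by positivity) x
  have key := hasDerivAt_integral_of_dominated_loc_of_deriv_le (μ := volume)
    (F := fun (t : ℝ) (x : EuclideanSpace ℝ (Fin N)) => (‖x‖ ^ N)⁻¹ * w (t • x))
    (F' := fun (t : ℝ) (x : EuclideanSpace ℝ (Fin N)) => (‖x‖ ^ N)⁻¹ * fderiv ℝ w (t • x) x)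
    (x₀ := (1 : ℝ)) (s := Set.Ioo (1 / 2) 2) (bound := B)
    (Ioo_mem_nhds (by norm_num) (by norm_num)) ?_ ?_ ?_ ?_ ?_ ?_
  · simp only [one_smul] at key
    refine ⟨key.1, ?_⟩
    have hconst : (fun t : ℝ => ∫ x : EuclideanSpace ℝ (Fin N), (‖x‖ ^ N)⁻¹ * w (t • x))
        =ᶠ[𝓝 1] fun _ => ∫ x : EuclideanSpace ℝ (Fin N), (‖x‖ ^ N)⁻¹ * w x := by
      filter_upwards [Ioi_mem_nhds (zero_lt_one : (0 : ℝ) < 1)] with t ht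
      have ht : 0 < t := ht
      have e1 : ∀ x : EuclideanSpace ℝ (Fin N), (‖x‖ ^ N)⁻¹ * w (t • x) =
          t ^ N * ((‖t • x‖ ^ N)⁻¹ * w (t • x)) := fun x => by
        rw [norm_smul, Real.norm_of_nonneg ht.le, mul_pow, mul_inv]
        field_simp
      simp_rw [e1]
      rw [integral_const_mul, Measure.integral_comp_smul volume
        (fun x : EuclideanSpace ℝ (Fin N) => (‖x‖ ^ N)⁻¹ * w x) t, finrank_euclideanSpace_fin,
        abs_of_pos (by positivity), smul_eq_mul, ← mul_assoc, mul_inv_cancel₀ (by positivity),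
        one_mul]
    exact key.2.unique ((hasDerivAt_const _ _).congr_of_eventuallyEq hconst)
  · exact Eventually.of_forall fun t => (hmeas.aestronglyMeasurable).mul
      (hw.continuous.comp (continuous_const_smul t)).aestronglyMeasurable
  · simp only [one_smul]
    refine integrable_of_bdd (C := (r ^ N)⁻¹ * D) (R := R)
      (hmeas.aestronglyMeasurable.mul hw.continuous.aestronglyMeasurable) (fun x => ?_)
      (fun x hx => by rw [hR x hx, mul_zero])
    rcases lt_or_ge ‖x‖ r with hx | hx
    · rw [h0 x hx, mul_zero, norm_zero]; positivity
    · rw [norm_mul]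
      exact mul_le_mul (hq hr x hx) (hD x) (norm_nonneg _) (by positivity)
  · simp only [one_smul]
    exact hmeas.aestronglyMeasurable.mul (hg.clm_apply continuous_id).aestronglyMeasurable
  · refine Eventually.of_forall fun x t ht => ?_
    have ht0 : 0 < t := by linarith [ht.1]
    have hn : ‖t • x‖ = t * ‖x‖ := by rw [norm_smul, Real.norm_of_nonneg ht0.le]
    rcases lt_or_ge ‖t • x‖ r with hx | hx
    · rw [hg0 _ hx]; simpa using hB0 x
    rcases lt_or_ge R' ‖t • x‖ with hx' | hx'
    · rw [hR' _ hx']; simpa using hB0 x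
    have hxl : r / 2 ≤ ‖x‖ := by nlinarith [ht.2, norm_nonneg x]
    have hxu : ‖x‖ ≤ 2 * R' := by nlinarith [ht.1, norm_nonneg x]
    have : B x = ((r / 2) ^ N)⁻¹ * (C * (2 * R')) :=
      Set.indicator_of_mem (by simpa using hxu) _
    rw [this, norm_mul]
    refine mul_le_mul (hq (by positivity) x hxl) ?_ (norm_nonneg _) (by positivity)
    exact (ContinuousLinearMap.le_opNorm _ _).trans
      (mul_le_mul (hC _) hxu (norm_nonneg _) hC0)
  · rw [integrable_indicator_iff measurableSet_closedBall]
    exact integrableOn_const measure_closedBall_lt_top.ne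
  · refine Eventually.of_forall fun x t ht => ?_
    have h1 : HasDerivAt (fun t : ℝ => t • x) x t := by
      simpa using (hasDerivAt_id t).smul_const x
    have h2 := ((hw.differentiable one_ne_zero) (t • x)).hasFDerivAt.comp_hasDerivAt t h1
    exact h2.const_mul _

lemma hasFDerivAt_v (c lam : ℝ) {x : EuclideanSpace ℝ (Fin N)} (hx : x ≠ 0) :
    HasFDerivAt (fun y : EuclideanSpace ℝ (Fin N) => c * ‖y‖ ^ lam)
      (innerSL ℝ ((c * lam * ‖x‖ ^ (lam - 2)) • x)) x := by
  have hn : 0 < ‖x‖ := norm_pos_iff.2 hx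
  have h1 : HasFDerivAt (fun y : EuclideanSpace ℝ (Fin N) => ‖y‖ ^ 2) _ x :=
    (hasFDerivAt_id x).norm_sq
  have h2 := (h1.rpow_const (p := lam / 2) (Or.inl (by positivity))).const_mul c
  have e : (fun y : EuclideanSpace ℝ (Fin N) => c * ‖y‖ ^ lam) =
      fun y => c * (‖y‖ ^ 2) ^ (lam / 2) := by
    funext y
    rw [← Real.rpow_natCast, ← Real.rpow_mul (norm_nonneg y)]
    congr 2; push_cast; ring
  rw [e]
  refine h2.congr_fderiv ?_
  have e2 : (‖x‖ ^ 2) ^ (lam / 2 - 1) = ‖x‖ ^ (lam - 2) := by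
    rw [← Real.rpow_natCast, ← Real.rpow_mul (norm_nonneg x)]
    congr 1; push_cast; ring
  refine ContinuousLinearMap.ext fun y => ?_
  simp [e2, real_inner_smul_left]
  ring

lemma A_grad_v {p lam : ℝ} (hp : 1 < p) (hlam : lam = (p - N) / (p - 1)) (c : ℝ)
    {x : EuclideanSpace ℝ (Fin N)} (hx : x ≠ 0) :
    A p ((c * lam * ‖x‖ ^ (lam - 2)) • x) =
      (|c * lam| ^ (p - 2) * (c * lam) * (‖x‖ ^ N)⁻¹) • x := by
  have hn : 0 < ‖x‖ := norm_pos_iff.2 hx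
  have hn1 : ‖(c * lam * ‖x‖ ^ (lam - 2)) • x‖ = |c * lam| * ‖x‖ ^ (lam - 1) := by
    rw [norm_smul, norm_mul, Real.norm_eq_abs, Real.norm_of_nonneg (by positivity), mul_assoc,
      ← Real.rpow_add_one hn.ne']
    congr 2; ring
  rw [A, hn1, smul_smul, Real.mul_rpow (abs_nonneg _) (by positivity), ← Real.rpow_mul hn.le]
  congr 1
  have : (‖x‖ ^ N)⁻¹ = ‖x‖ ^ ((lam - 1) * (p - 2)) * ‖x‖ ^ (lam - 2) := by
    rw [← Real.rpow_natCast, ← Real.rpow_neg hn.le, ← Real.rpow_add hn]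
    congr 1
    rw [hlam]
    have : p - 1 ≠ 0 := by linarith
    field_simp
    ring
  rw [this]; ring

lemma compare {p lam : ℝ} (hp : 1 < p) (hpN : p < N) (hlam : lam = (p - N) / (p - 1))
    {u : EuclideanSpace ℝ (Fin N) → ℝ} (hu : ContDiff ℝ 1 u) (hu0 : ∀ x, 0 ≤ u x)
    (hsuper : ∀ φ : EuclideanSpace ℝ (Fin N) → ℝ,
      ContDiff ℝ (⊤ : ℕ∞) φ → HasCompactSupport φ → (∀ x, 0 ≤ φ x) →
      0 ≤ ∫ x, ‖gradient u x‖ ^ (p - 2) * ⟪gradient u x, gradient φ x⟫)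
    {c ε r : ℝ} (hr : 0 < r) (hε : 0 < ε) (hb : ∀ x, ‖x‖ = r → c * ‖x‖ ^ lam - ε < u x) :
    ∀ x, r < ‖x‖ → c * ‖x‖ ^ lam - ε ≤ u x := by
  have hlam0 : 0 < -lam := by
    rw [hlam, ← neg_div]; apply div_pos <;> linarith
  have hgu : Continuous (gradient u) :=
    (InnerProductSpace.toDual ℝ _).symm.continuous.comp (hu.continuous_fderiv one_ne_zero)
  have hF : Continuous fun x => A p (gradient u x) := (continuous_A hp).comp hgu
  have hsuper' : ∀ φ : EuclideanSpace ℝ (Fin N) → ℝ,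
      ContDiff ℝ (⊤ : ℕ∞) φ → HasCompactSupport φ → (∀ x, 0 ≤ φ x) →
      0 ≤ ∫ x, fderiv ℝ φ x (A p (gradient u x)) := fun φ h1 h2 h3 => by
    convert hsuper φ h1 h2 h3 using 2
    funext x
    rw [← toDual_gradient, InnerProductSpace.toDual_apply_apply, A, real_inner_smul_right,
      real_inner_comm]
  -- the comparison function
  set h : EuclideanSpace ℝ (Fin N) → ℝ := fun x => c * ‖x‖ ^ lam - ε - u x with hh
  set w : EuclideanSpace ℝ (Fin N) → ℝ := fun x => if r < ‖x‖ then expNegInvGlue (h x) else 0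
    with hwdef
  have hψ : ContDiff ℝ 1 expNegInvGlue := expNegInvGlue.contDiff (n := 1)
  have hhc : ∀ x, x ≠ 0 → ContDiffAt ℝ 1 h x := fun x hx =>
    ((contDiffAt_const.mul ((contDiffAt_norm ℝ hx).rpow_const_of_ne
      (norm_ne_zero_iff.2 hx))).sub contDiffAt_const).sub hu.contDiffAt
  have hin : ∀ x, r < ‖x‖ → w =ᶠ[𝓝 x] fun y => expNegInvGlue (h y) := fun x hx => by
    filter_upwards [(isOpen_lt continuous_const continuous_norm).mem_nhds hx] with y hy
    exact if_pos hy
  have hout : ∀ x, ‖x‖ ≤ r → w =ᶠ[𝓝 x] fun _ => 0 := fun x hx => by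
    rcases hx.lt_or_eq with hx | hx
    · filter_upwards [(isOpen_lt continuous_norm continuous_const).mem_nhds hx] with y hy
      exact if_neg (not_lt.2 (le_of_lt hy))
    · have hx0 : x ≠ 0 := norm_pos_iff.1 (hx ▸ hr)
      have hneg : h x < 0 := by simp only [hh]; linarith [hb x hx]
      filter_upwards [(hhc x hx0).continuousAt.eventually_lt continuousAt_const hneg] with y hy
      simp only [hwdef]
      rw [expNegInvGlue.zero_of_nonpos hy.le, ite_self]
  have hne : ∀ x : EuclideanSpace ℝ (Fin N), r < ‖x‖ → x ≠ 0 := fun x hx =>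
    norm_pos_iff.1 (hr.trans hx)
  have hw : ContDiff ℝ 1 w := by
    rw [contDiff_iff_contDiffAt]
    intro x
    rcases lt_or_ge r ‖x‖ with hx | hx
    · exact (hψ.contDiffAt.comp x (hhc x (hne x hx))).congr_of_eventuallyEq (hin x hx)
    · exact contDiffAt_const.congr_of_eventuallyEq (hout x hx)
  have hw0 : ∀ x, 0 ≤ w x := fun x => by
    simp only [hwdef]; split_ifs
    · exact expNegInvGlue.nonneg _
    · exact le_rfl
  have hwr : ∀ x, ‖x‖ < r → w x = 0 := fun x hx => if_neg (not_lt.2 hx.le)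
  obtain ⟨R, hR⟩ : ∃ R, ∀ x : EuclideanSpace ℝ (Fin N), R ≤ ‖x‖ → w x = 0 := by
    have ht : Tendsto (fun s : ℝ => c * s ^ lam) atTop (𝓝 0) := by
      have := (tendsto_rpow_neg_atTop hlam0).const_mul c
      simpa using this
    obtain ⟨R, hR⟩ := eventually_atTop.1 (ht.eventually_lt_const hε)
    refine ⟨R, fun x hx => ?_⟩
    have h1 := hR ‖x‖ hx
    simp only [hwdef]
    rw [expNegInvGlue.zero_of_nonpos, ite_self]
    simp only [hh]; linarith [hu0 x]
  have hc : HasCompactSupport w :=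
    HasCompactSupport.intro (isCompact_closedBall 0 R) fun x hx =>
      hR x (le_of_lt (by simpa using hx))
  set k := |c * lam| ^ (p - 2) * (c * lam) with hk
  obtain ⟨hi2, hz⟩ := scaling hw hc hr hwr
  have hpos := mollify hF hsuper' hw hc hw0
  have hgw : Continuous (fderiv ℝ w) := hw.continuous_fderiv one_ne_zero
  have hi1 : Integrable fun x => fderiv ℝ w x (A p (gradient u x)) := by
    refine (hgw.clm_apply hF).integrable_of_hasCompactSupport ?_
    refine (hc.fderiv ℝ).mono fun x hx => ?_
    simp only [Function.mem_support] at hx ⊢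
    intro h0; rw [h0] at hx; simp at hx
  set G : EuclideanSpace ℝ (Fin N) → ℝ := fun x =>
    k * ((‖x‖ ^ N)⁻¹ * fderiv ℝ w x x) - fderiv ℝ w x (A p (gradient u x)) with hG
  have hiG : Integrable G := (hi2.const_mul k).sub hi1
  have hGint : ∫ x, G x ≤ 0 := by
    rw [hG, integral_sub (hi2.const_mul k) hi1, integral_const_mul, hz]
    linarith
  have hfd : ∀ x, r < ‖x‖ → ∀ y, fderiv ℝ w x y =
      deriv expNegInvGlue (h x) * ⟪(c * lam * ‖x‖ ^ (lam - 2)) • x - gradient u x, y⟫ :=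
    fun x hx y => by
    have d1 : HasFDerivAt h (innerSL ℝ ((c * lam * ‖x‖ ^ (lam - 2)) • x) - fderiv ℝ u x) x :=
      ((hasFDerivAt_v c lam (hne x hx)).sub_const ε).sub
        ((hu.differentiable one_ne_zero) x).hasFDerivAt
    have d2 := ((hψ.differentiable one_ne_zero) (h x)).hasDerivAt.comp_hasFDerivAt x d1
    rw [(hin x hx).fderiv_eq]
    have d3 : fderiv ℝ (fun y => expNegInvGlue (h y)) x = _ := d2.fderiv
    rw [d3, ← toDual_gradient, inner_sub_left]
    simp [real_inner_smul_left]
  have hfd0 : ∀ x, ‖x‖ ≤ r → fderiv ℝ w x = 0 := fun x hx => by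
    rw [(hout x hx).fderiv_eq]; simp
  have hGe : ∀ x, r < ‖x‖ → G x = deriv expNegInvGlue (h x) *
      ⟪A p ((c * lam * ‖x‖ ^ (lam - 2)) • x) - A p (gradient u x),
        (c * lam * ‖x‖ ^ (lam - 2)) • x - gradient u x⟫ := fun x hx => by
    have e : k * ((‖x‖ ^ N)⁻¹ * fderiv ℝ w x x) =
        fderiv ℝ w x (A p ((c * lam * ‖x‖ ^ (lam - 2)) • x)) := by
      rw [A_grad_v hp hlam c (hne x hx), map_smul, smul_eq_mul, mul_assoc k]
    simp only [hG]
    rw [e, ← map_sub, hfd x hx, real_inner_comm]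
  have hψ' : ∀ t, 0 ≤ deriv expNegInvGlue t := fun t => expNegInvGlue.monotone.deriv_nonneg
  have hG0 : 0 ≤ G := fun x => by
    rcases lt_or_ge r ‖x‖ with hx | hx
    · rw [hGe x hx]
      exact mul_nonneg (hψ' _) (inner_A_nonneg hp _ _)
    · simp [hG, hfd0 x hx]
  have hGae := (integral_eq_zero_iff_of_nonneg hG0 hiG).1
    (le_antisymm hGint (integral_nonneg hG0))
  have hfdae : fderiv ℝ w =ᵐ[volume] fun _ => 0 := by
    filter_upwards [hGae] with x hx
    rcases lt_or_ge r ‖x‖ with hxr | hxr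
    · rw [hGe x hxr] at hx
      ext y
      rw [hfd x hxr y]
      rcases mul_eq_zero.1 hx with h1 | h1
      · simp [h1]
      · simp [eq_of_inner_A hp h1]
    · exact hfd0 x hxr
  have hfdz := (hgw.ae_eq_iff_eq volume continuous_const).1 hfdae
  have hwz : ∀ x, w x = 0 := fun x => by
    have hN : 0 < N := by
      have : (0 : ℝ) < N := by linarith
      exact_mod_cast this
    have : Nonempty (Fin N) := ⟨⟨0, hN⟩⟩
    obtain ⟨y, hy⟩ := NormedSpace.exists_lt_norm ℝ (EuclideanSpace ℝ (Fin N)) R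
    rw [is_const_of_fderiv_eq_zero (hw.differentiable one_ne_zero) (fun x => congrFun hfdz x) x y]
    exact hR y hy.le
  intro x hx
  have h1 := hwz x
  simp only [hwdef, if_pos hx, expNegInvGlue.zero_iff_nonpos] at h1
  simp only [hh] at h1
  linarith

end Hadamard

/-- For `1 < p < N` and a nonnegative p-superharmonic function `u`, the function
`r ↦ m(r) r^{-λ}` is nondecreasing, where `λ = (p-N)/(p-1) < 0`;
equivalently `m(r) ≥ m(r₁)(r/r₁)^λ` for `0 < r₁ ≤ r`. -/
theorem hadamard_monotonicity
    (N : ℕ) (p : ℝ) (hp : 1 < p) (hpN : p < N)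
    (lam : ℝ) (hlam : lam = (p - N) / (p - 1))
    (u : EuclideanSpace ℝ (Fin N) → ℝ)
    (hu : ContDiff ℝ 1 u) (hu_nonneg : ∀ x, 0 ≤ u x)
    (hsuper : ∀ φ : EuclideanSpace ℝ (Fin N) → ℝ,
      ContDiff ℝ (⊤ : ℕ∞) φ → HasCompactSupport φ → (∀ x, 0 ≤ φ x) →
      0 ≤ ∫ x, ‖gradient u x‖ ^ (p - 2) * ⟪gradient u x, gradient φ x⟫)
    (m : ℝ → ℝ)
    (hm : ∀ r : ℝ, m r = sInf (u '' closedBall (0 : EuclideanSpace ℝ (Fin N)) r)) :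
    (∀ r₁ r : ℝ, 0 < r₁ → r₁ ≤ r → m r₁ * (r / r₁) ^ lam ≤ m r) ∧
      MonotoneOn (fun r => m r * r ^ (-lam)) (Set.Ioi (0 : ℝ)) := by
  have hlam0 : lam < 0 := by
    rw [hlam]; exact div_neg_of_neg_of_pos (by linarith) (by linarith)
  have hbdd : ∀ s, BddBelow (u '' closedBall (0 : EuclideanSpace ℝ (Fin N)) s) := fun s =>
    ⟨0, by rintro _ ⟨x, -, rfl⟩; exact hu_nonneg x⟩
  have main : ∀ r₁ r : ℝ, 0 < r₁ → r₁ ≤ r → m r₁ * (r / r₁) ^ lam ≤ m r := by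
    intro r₁ r h1 h12
    have hmle : ∀ x, ‖x‖ ≤ r₁ → m r₁ ≤ u x := fun x hx => by
      rw [hm]; exact csInf_le (hbdd r₁) ⟨x, by simpa using hx, rfl⟩
    have hm0 : 0 ≤ m r₁ := by
      rw [hm]; apply Real.sInf_nonneg; rintro _ ⟨x, -, rfl⟩; exact hu_nonneg x
    have hr : 0 < r := h1.trans_le h12
    have hout : ∀ x, r₁ < ‖x‖ → m r₁ * (‖x‖ / r₁) ^ lam ≤ u x := fun x hx => by
      refine le_of_forall_pos_sub_le fun ε hε => ?_
      have e : ∀ y : EuclideanSpace ℝ (Fin N),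
          m r₁ * (‖y‖ / r₁) ^ lam = m r₁ / r₁ ^ lam * ‖y‖ ^ lam := fun y => by
        rw [Real.div_rpow (norm_nonneg y) h1.le]; ring
      rw [e]
      refine Hadamard.compare hp hpN hlam hu hu_nonneg hsuper h1 hε (fun y hy => ?_) x hx
      rw [← e, hy, div_self h1.ne', Real.one_rpow]
      linarith [hmle y hy.le]
    rw [hm r]
    refine le_csInf ⟨_, 0, by simpa using hr.le, rfl⟩ ?_
    rintro _ ⟨x, hx, rfl⟩
    have hx : ‖x‖ ≤ r := by simpa using hx
    rcases lt_or_ge r₁ ‖x‖ with hxr | hxr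
    · refine le_trans (mul_le_mul_of_nonneg_left ?_ hm0) (hout x hxr)
      exact Real.rpow_le_rpow_of_nonpos (div_pos (h1.trans hxr) h1)
        (div_le_div_of_nonneg_right hx h1.le) hlam0.le
    · refine le_trans ?_ (hmle x hxr)
      exact mul_le_of_le_one_right hm0
        (Real.rpow_le_one_of_one_le_of_nonpos ((one_le_div h1).2 h12) hlam0.le)
  refine ⟨main, fun a ha b hb hab => ?_⟩
  have ha : 0 < a := ha
  have hb : 0 < b := hb
  have h := mul_le_mul_of_nonneg_right (main a b ha hab) (Real.rpow_nonneg hb.le (-lam))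
  have e : (b / a) ^ lam * b ^ (-lam) = a ^ (-lam) := by
    rw [Real.div_rpow hb.le ha.le, Real.rpow_neg hb.le, Real.rpow_neg ha.le]
    have := (Real.rpow_pos_of_pos hb lam).ne'
    field_simp
  rwa [mul_assoc, e] at h
end

section
/- Let N > p > 1 and let h : ℝ^N → ℝ be continuous and nonnegative with h(x) = a|x|^γ for all |x| ≥ R₀, where a > 0, γ > −p and R₀ > 0 are constants. Let q satisfy p − 1 < q ≤ (N+γ)(p−1)/(N−p). If u : ℝ^N → ℝ is a nonnegative C¹ function satisfying ∫_{ℝ^N} |∇u(x)|^{p−2}⟨∇u(x), ∇φ(x)⟩ dx ≥ ∫_{ℝ^N} h(x) u(x)^q φ(x) dx for every nonnegative C^∞ compactly supported φ : ℝ^N → ℝ, then u ≡ 0. -/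
open MeasureTheory Metric
open scoped RealInnerProductSpace

/-- Young-type pointwise inequality. -/
lemma young_aux {p x a b : ℝ} (hp : 1 < p) (hx : 0 ≤ x) (ha : 0 < a) (hb : 0 ≤ b) :
    x ^ (p - 1) * b - a * x ^ p ≤ b ^ p * a ^ (1 - p) := by
  rcases le_or_gt (a * x) b with h | h
  · have h1 : x ≤ b / a := by rw [le_div_iff₀ ha]; linarith
    have h2 : x ^ (p - 1) ≤ (b / a) ^ (p - 1) := Real.rpow_le_rpow hx h1 (by linarith)
    have h3 : (b / a) ^ (p - 1) * b = b ^ p * a ^ (1 - p) := by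
      rw [Real.div_rpow hb ha.le, show (1 - p) = -(p - 1) by ring, Real.rpow_neg ha.le]
      have : b ^ p = b ^ (p - 1) * b := by
        rcases hb.eq_or_lt with h | h
        · rw [← h, Real.zero_rpow (by linarith)]; simp
        · rw [← Real.rpow_add_one h.ne']; ring_nf
      rw [this]; ring
    have h4 : 0 ≤ a * x ^ p := by positivity
    have := mul_le_mul_of_nonneg_right h2 hb
    linarith
  · have hx0 : 0 < x := by
      rcases hx.eq_or_lt with h' | h'
      · rw [← h'] at h; simp at h; linarith
      · exact h'
    have : x ^ p = x ^ (p - 1) * x := by rw [← Real.rpow_add_one hx0.ne']; ring_nf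
    have h5 : 0 ≤ x ^ (p - 1) := by positivity
    have h6 : 0 ≤ b ^ p * a ^ (1 - p) := by positivity
    rw [this]
    nlinarith

/-- absorption inequality -/
lemma absorb_aux {s ψ m q p k : ℝ} (hs : 1 ≤ s) (hψ : 0 < ψ) (hψ1 : ψ ≤ 1) (hm : 0 ≤ m)
    (hmq : m ≤ q) (hq : 0 < q) (hk : p ≤ k * (1 - m / q)) :
    s ^ m * ψ ^ (k - p) ≤ 1 + s ^ q * ψ ^ k := by
  have hs0 : 0 < s := by linarith
  set τ := s * ψ ^ (k / q) with hτ
  have hτ0 : 0 < τ := by positivity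
  have h1 : ψ ^ (k - p) ≤ (ψ ^ (k / q)) ^ m := by
    rw [← Real.rpow_mul hψ.le]
    apply Real.rpow_le_rpow_of_exponent_ge hψ hψ1
    have : k * (1 - m / q) = k - k / q * m := by ring
    linarith
  have h2 : s ^ m * ψ ^ (k - p) ≤ τ ^ m := by
    rw [hτ, Real.mul_rpow hs0.le (by positivity)]
    gcongr
  have h3 : τ ^ q = s ^ q * ψ ^ k := by
    rw [hτ, Real.mul_rpow hs0.le (by positivity), ← Real.rpow_mul hψ.le, div_mul_cancel₀ _ hq.ne']
  have h4 : τ ^ m ≤ 1 + τ ^ q := by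
    rcases le_total τ 1 with h | h
    · have := Real.rpow_le_one hτ0.le h hm
      have : 0 ≤ τ ^ q := by positivity
      linarith
    · have := Real.rpow_le_rpow_of_exponent_le h hmq
      linarith
  linarith

lemma one_add_rpow_aux {t q : ℝ} (ht : 0 ≤ t) (hq : 0 < q) :
    (1 + t) ^ q ≤ 2 ^ q * (1 + t ^ q) := by
  have : 0 ≤ t ^ q := by positivity
  have h2 : (0:ℝ) < 2 ^ q := by positivity
  rcases le_total t 1 with h | h
  · have : (1 + t) ^ q ≤ 2 ^ q := Real.rpow_le_rpow (by linarith) (by linarith) hq.le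
    nlinarith
  · have : (1 + t) ^ q ≤ (2 * t) ^ q := Real.rpow_le_rpow (by linarith) (by linarith) hq.le
    rw [Real.mul_rpow (by norm_num) ht] at this
    nlinarith

/-- the complete pointwise estimate -/
lemma pointwise_aux {p q α lam G ψ D t : ℝ} {k : ℕ} (hp : 1 < p) (hα : 0 < α)
    (hlam : 0 < lam) (hG : 0 ≤ G) (hψ : 0 ≤ ψ) (hψ1 : ψ ≤ 1) (hD : 0 ≤ D) (ht : 0 ≤ t)
    (hmq : (1 + α) * (p - 1) ≤ q) (hk2 : 2 ≤ k)
    (hk : p ≤ k * (1 - (1 + α) * (p - 1) / q)) :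
    2 * k * ψ ^ (k - 1) * G ^ (p - 1) * D
      - α / lam * (1 + t / lam) ^ (-α - 1) * ψ ^ k * G ^ p ≤
    (2 * k) ^ p * α ^ (1 - p) * lam ^ (p - 1) * D ^ p *
      (2 * 2 ^ q * (1 + (t / lam) ^ q * ψ ^ k)) := by
  have hm : 0 < (1 + α) * (p - 1) := mul_pos (by linarith) (by linarith)
  have hq : 0 < q := by linarith
  have htl : 0 ≤ t / lam := by positivity
  have hs : 1 ≤ 1 + t / lam := by linarith
  rcases hψ.eq_or_lt with h0 | h0
  · rw [← h0]
    have z1 : (0:ℝ) ^ (k - 1) = 0 := zero_pow (by omega)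
    have z2 : (0:ℝ) ^ k = 0 := zero_pow (by omega)
    have h9 : 0 ≤ (2 * (k:ℝ)) ^ p * α ^ (1 - p) * lam ^ (p - 1) * D ^ p *
      (2 * 2 ^ q * (1 + (t / lam) ^ q * (0:ℝ) ^ k)) := by positivity
    refine le_trans (le_of_eq ?_) h9
    rw [z1, z2]; ring
  have hs0 : 0 < 1 + t / lam := by linarith
  have hkc : (0:ℝ) < k := by exact_mod_cast (by omega : 0 < k)
  have hY := young_aux (x := G) (a := α / lam * (1 + t / lam) ^ (-α - 1) * ψ ^ k)
    (b := 2 * k * ψ ^ (k - 1) * D) hp hG (by positivity) (by positivity)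
  have hA := absorb_aux (s := 1 + t / lam) (k := k) hs h0 hψ1 hm.le hmq hq hk
  have hO := one_add_rpow_aux htl hq
  have e1 : (2 * k * ψ ^ (k - 1) * D) ^ p * (α / lam * (1 + t / lam) ^ (-α - 1) * ψ ^ k) ^ (1 - p)
     = (2 * k) ^ p * α ^ (1 - p) * lam ^ (p - 1) * D ^ p *
        ((1 + t / lam) ^ ((1 + α) * (p - 1)) * ψ ^ ((k:ℝ) - p)) := by
    rw [Real.mul_rpow (x := 2 * k * ψ ^ (k - 1)) (by positivity) hD,
      Real.mul_rpow (x := 2 * (k:ℝ)) (y := ψ ^ (k - 1)) (by positivity) (by positivity),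
      Real.mul_rpow (y := ψ ^ k) (by positivity) (by positivity),
      Real.mul_rpow (x := α / lam) (by positivity) (by positivity),
      Real.div_rpow hα.le hlam.le, ← Real.rpow_mul hs0.le]
    rw [← Real.rpow_natCast ψ (k-1), ← Real.rpow_natCast ψ k, ← Real.rpow_mul h0.le,
      ← Real.rpow_mul h0.le, Nat.cast_sub (by omega)]
    rw [show (-α - 1) * (1 - p) = (1 + α) * (p - 1) by ring]
    rw [show (k:ℝ) - p = ((k:ℝ) - (1:ℕ)) * p + k * (1 - p) by push_cast; ring, Real.rpow_add h0]
    rw [show (p - 1) = -(1 - p) by ring, Real.rpow_neg hlam.le]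
    ring
  rw [e1] at hY
  have hψk : ψ ^ k ≤ 1 := pow_le_one₀ hψ hψ1
  have hψk0 : 0 < ψ ^ k := by positivity
  have h2q : (1:ℝ) ≤ 2 ^ q := Real.one_le_rpow (by norm_num) hq.le
  have e2 : (1 + t / lam) ^ ((1 + α) * (p - 1)) * ψ ^ ((k:ℝ) - p) ≤
      2 * 2 ^ q * (1 + (t / lam) ^ q * ψ ^ k) := by
    rw [Real.rpow_natCast] at hA
    have hT : 0 ≤ (t / lam) ^ q := by positivity
    have : (1 + t / lam) ^ q * ψ ^ k ≤ 2 ^ q * (1 + (t/lam) ^ q) * ψ ^ k := by gcongr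
    have h7 : 0 ≤ 2 ^ q * ((t/lam) ^ q * ψ ^ k) := by positivity
    have h8 : 2 ^ q * ψ ^ k ≤ 2 ^ q * 1 := by gcongr
    nlinarith
  have e3 : 0 ≤ (2 * k) ^ p * α ^ (1 - p) * lam ^ (p - 1) * D ^ p := by positivity
  have := mul_le_mul_of_nonneg_left e2 e3
  calc _ = G ^ (p - 1) * (2 * k * ψ ^ (k - 1) * D)
      - α / lam * (1 + t / lam) ^ (-α - 1) * ψ ^ k * G ^ p := by ring
    _ ≤ _ := hY.trans this

/-- The final limiting argument. -/
lemma limit_aux {p q C R₁ : ℝ} (hp : 1 < p) (hq : p - 1 < q) (hC : 0 < C)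
    (F J I : ℝ → ℝ) (hmono : Monotone F)
    (hFJ : ∀ R, R₁ ≤ R → F R ≤ J R) (hIJ : ∀ R, R₁ ≤ R → I R ≤ J R)
    (hIF : ∀ R, R₁ ≤ R → I R ≤ F (2 * R) - F R)
    (hJ : ∀ R, R₁ ≤ R → ∀ K, 0 < K → J R ≤ C * (K ^ (p - 1) + K ^ (p - 1 - q) * I R)) :
    ∀ R, F R ≤ 0 := by
  -- boundedness
  obtain ⟨K₀, hK₀, hK₀'⟩ : ∃ K₀ : ℝ, 0 < K₀ ∧ C * K₀ ^ (p - 1 - q) = 1 / 2 := by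
    refine ⟨(1 / (2 * C)) ^ (1 / (p - 1 - q)), by positivity, ?_⟩
    rw [← Real.rpow_mul (by positivity), one_div_mul_cancel (by linarith), Real.rpow_one]
    field_simp
  have hbd : ∀ R, F R ≤ 2 * C * K₀ ^ (p - 1) := by
    intro R
    have h1 := hJ (max R R₁) (le_max_right _ _) K₀ hK₀
    have h2 := hIJ (max R R₁) (le_max_right _ _)
    have h3 := hFJ (max R R₁) (le_max_right _ _)
    have h4 := hmono (le_max_left R R₁)
    have h5 : C * (K₀ ^ (p - 1 - q) * I (max R R₁)) = 1 / 2 * I (max R R₁) := by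
      rw [← mul_assoc, hK₀']
    rw [mul_add, h5] at h1
    linarith
  have hB : BddAbove (Set.range F) := ⟨_, by rintro _ ⟨R, rfl⟩; exact hbd R⟩
  have hT := tendsto_atTop_ciSup hmono hB
  set L := ⨆ R, F R
  have hL : ∀ K : ℝ, 0 < K → L ≤ C * K ^ (p - 1) := by
    intro K hK
    have hT2 : Filter.Tendsto (fun R => F (2 * R)) Filter.atTop (nhds L) :=
      hT.comp (Filter.tendsto_id.const_mul_atTop (by norm_num : (0:ℝ) < 2))
    have hT3 : Filter.Tendsto (fun R => C * (K ^ (p - 1) + K ^ (p - 1 - q) * (F (2 * R) - F R)))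
        Filter.atTop (nhds (C * (K ^ (p - 1) + K ^ (p - 1 - q) * (L - L)))) :=
      (((hT2.sub hT).const_mul _).const_add _).const_mul _
    have := le_of_tendsto_of_tendsto hT hT3 (by
      filter_upwards [Filter.eventually_ge_atTop R₁] with R hR
      refine (hFJ R hR).trans ((hJ R hR K hK).trans ?_)
      have := hIF R hR
      gcongr)
    simpa using this
  have hL0 : L ≤ 0 := by
    by_contra! hpos
    have := hL ((L / (2 * C)) ^ (1 / (p - 1))) (by positivity)
    rw [← Real.rpow_mul (by positivity), one_div_mul_cancel (by linarith), Real.rpow_one] at this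
    have : C * (L / (2 * C)) = L / 2 := by field_simp
    linarith
  exact fun R => (le_ciSup hB R).trans hL0

lemma flux_cont {E : Type*} [NormedAddCommGroup E] [NormedSpace ℝ E] {p : ℝ} (hp : 1 < p) :
    Continuous (fun v : E => ‖v‖ ^ (p - 2) • v) := by
  rw [continuous_iff_continuousAt]
  intro v
  by_cases hv : v = 0
  · subst hv
    rw [ContinuousAt, smul_zero, tendsto_zero_iff_norm_tendsto_zero]
    have hc : Continuous (fun v : E => ‖v‖ ^ (p - 1)) :=
      continuous_norm.rpow_const (fun _ => Or.inr (by linarith))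
    have h0 := hc.tendsto 0
    simp only [norm_zero] at h0
    rw [Real.zero_rpow (by linarith)] at h0
    refine h0.congr fun w => ?_
    rw [norm_smul, Real.norm_of_nonneg (by positivity)]
    by_cases hw : w = 0
    · simp [hw, Real.zero_rpow (by linarith : p - 1 ≠ 0)]
    · rw [← Real.rpow_add_one (norm_ne_zero_iff.2 hw)]; ring_nf
  · exact (continuousAt_id.norm.rpow_const (Or.inl (norm_ne_zero_iff.2 hv))).smul continuousAt_id

/-- Mollification lemma: the mollified functions and their dominated convergence. -/
lemma mollify_integral {N : ℕ} {V : Type*} [NormedAddCommGroup V] [NormedSpace ℝ V]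
    [CompleteSpace V]
    (b : ℕ → ContDiffBump (0 : EuclideanSpace ℝ (Fin N)))
    (hb : Filter.Tendsto (fun n => (b n).rOut) Filter.atTop (nhds 0))
    (hb1 : ∀ n, (b n).rOut ≤ 1)
    (w : EuclideanSpace ℝ (Fin N) → V) (hw : Continuous w) (hwc : HasCompactSupport w)
    (ℓ : EuclideanSpace ℝ (Fin N) → V →L[ℝ] ℝ) (hℓ : Continuous ℓ) :
    Filter.Tendsto (fun n => ∫ x, ℓ x
      ((convolution ((b n).normed volume) w (ContinuousLinearMap.lsmul ℝ ℝ) volume) x))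
      Filter.atTop (nhds (∫ x, ℓ x (w x))) := by
  obtain ⟨C, hC⟩ := hwc.exists_bound_of_continuous hw
  have hC0 : 0 ≤ C := (norm_nonneg _).trans (hC 0)
  obtain ⟨M, hM⟩ := hwc.isCompact.isBounded.subset_closedBall (0 : EuclideanSpace ℝ (Fin N))
  have hz : ∀ x, M < ‖x‖ → w x = 0 := by
    intro x hx
    by_contra h
    have := hM (subset_tsupport _ h)
    simp at this
    linarith
  have hcont : ∀ n, Continuous
      (convolution ((b n).normed volume) w (ContinuousLinearMap.lsmul ℝ ℝ) volume) := fun n =>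
    HasCompactSupport.continuous_convolution_left _ ((b n).hasCompactSupport_normed)
      ((b n).continuous_normed) hw.locallyIntegrable
  refine tendsto_integral_of_dominated_convergence
    ((closedBall (0 : EuclideanSpace ℝ (Fin N)) (M + 1)).indicator (fun x => ‖ℓ x‖ * (3 * C)))
    ?_ ?_ ?_ ?_
  · intro n
    exact (hℓ.clm_apply (hcont n)).aestronglyMeasurable
  · rw [integrable_indicator_iff measurableSet_closedBall]
    exact (hℓ.norm.mul continuous_const).continuousOn.integrableOn_compact
      (isCompact_closedBall _ _)
  · intro n
    refine Filter.Eventually.of_forall fun x => ?_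
    by_cases hx : x ∈ closedBall (0 : EuclideanSpace ℝ (Fin N)) (M + 1)
    · rw [Set.indicator_of_mem hx]
      refine (ContinuousLinearMap.le_opNorm _ _).trans ?_
      gcongr
      have := (b n).dist_normed_convolution_le (μ := volume) (g := w) (x₀ := x) (ε := 2 * C)
        hw.aestronglyMeasurable (by
          intro y _
          rw [dist_eq_norm]
          have := norm_sub_le (w y) (w x)
          linarith [hC x, hC y])
      rw [dist_eq_norm] at this
      have h2 := norm_add_le
        ((convolution ((b n).normed volume) w (ContinuousLinearMap.lsmul ℝ ℝ) volume) x - w x) (w x)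
      rw [sub_add_cancel] at h2
      linarith [hC x]
    · rw [Set.indicator_of_notMem hx]
      simp at hx
      have hx0 : w x = 0 := hz x (by linarith)
      rw [(b n).normed_convolution_eq_right (μ := volume), hx0]
      · simp
      · intro y hy
        rw [hx0]
        apply hz
        rw [mem_ball, dist_eq_norm] at hy
        have h3 := norm_sub_norm_le x y
        rw [norm_sub_rev] at h3
        linarith [hb1 n]
  · refine Filter.Eventually.of_forall fun x => ?_
    exact ((ℓ x).continuous.tendsto _).comp
      (ContDiffBump.convolution_tendsto_right_of_continuous hb hw x)

/-- Weak inequality extends to `C¹` test functions. -/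
lemma weak_C1 {N : ℕ} (F : EuclideanSpace ℝ (Fin N) → EuclideanSpace ℝ (Fin N))
    (g : EuclideanSpace ℝ (Fin N) → ℝ) (hF : Continuous F) (hg : Continuous g)
    (hw : ∀ φ : EuclideanSpace ℝ (Fin N) → ℝ,
      ContDiff ℝ (⊤ : ℕ∞) φ → HasCompactSupport φ → (∀ x, 0 ≤ φ x) →
      ∫ x, g x * φ x ≤ ∫ x, fderiv ℝ φ x (F x))
    (φ : EuclideanSpace ℝ (Fin N) → ℝ)
    (hφ : ContDiff ℝ 1 φ) (hφc : HasCompactSupport φ) (hφ0 : ∀ x, 0 ≤ φ x) :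
    ∫ x, g x * φ x ≤ ∫ x, fderiv ℝ φ x (F x) := by
  let b : ℕ → ContDiffBump (0 : EuclideanSpace ℝ (Fin N)) := fun n =>
    ⟨1 / ((n:ℝ) + 2), 1 / ((n:ℝ) + 1), by positivity, by
      apply one_div_lt_one_div_of_lt <;> [positivity; linarith]⟩
  have hb : Filter.Tendsto (fun n => (b n).rOut) Filter.atTop (nhds 0) :=
    tendsto_one_div_add_atTop_nhds_zero_nat
  have hb1 : ∀ n, (b n).rOut ≤ 1 := fun n => by
    change 1 / ((n:ℝ) + 1) ≤ 1
    rw [div_le_one (by positivity)]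
    have : (0:ℝ) ≤ n := by positivity
    linarith
  have T1 := mollify_integral b hb hb1 φ hφ.continuous hφc
    (fun x => g x • ContinuousLinearMap.id ℝ ℝ) (hg.smul continuous_const)
  have T2 := mollify_integral b hb hb1 (fderiv ℝ φ) (hφ.continuous_fderiv one_ne_zero)
    (hφc.fderiv ℝ) (fun x => ContinuousLinearMap.apply ℝ ℝ (F x))
    ((ContinuousLinearMap.continuous _).comp hF)
  simp only [smul_apply, ContinuousLinearMap.id_apply, smul_eq_mul,
    ContinuousLinearMap.apply_apply] at T1 T2
  refine le_of_tendsto_of_tendsto' T1 T2 fun n => ?_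
  have hli : LocallyIntegrable ((b n).normed volume) volume :=
    ((b n).continuous_normed).locallyIntegrable
  have key := hw (convolution ((b n).normed volume) φ (ContinuousLinearMap.lsmul ℝ ℝ) volume)
    (HasCompactSupport.contDiff_convolution_left _ ((b n).hasCompactSupport_normed)
      ((b n).contDiff_normed) hφ.continuous.locallyIntegrable)
    (HasCompactSupport.convolution _ ((b n).hasCompactSupport_normed) hφc)
    (fun x => by
      rw [convolution_def]
      refine integral_nonneg fun t => ?_
      simp only [ContinuousLinearMap.lsmul_apply, smul_eq_mul]
      exact mul_nonneg ((b n).nonneg_normed _) (hφ0 _))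
  refine key.trans (le_of_eq ?_)
  congr 1
  ext x
  have := hφc.hasFDerivAt_convolution_right (ContinuousLinearMap.lsmul ℝ ℝ) hli hφ x
  rw [this.fderiv]
  congr 1

/-- cutoff functions -/
lemma cutoff_exists (N : ℕ) : ∃ C₀ : ℝ, 0 < C₀ ∧ ∃ ψ : ℝ → EuclideanSpace ℝ (Fin N) → ℝ,
    ∀ R, 0 < R → ContDiff ℝ 1 (ψ R) ∧ (∀ x, 0 ≤ ψ R x) ∧ (∀ x, ψ R x ≤ 1) ∧
      (∀ x, ‖x‖ ≤ R → ψ R x = 1) ∧ (∀ x, 2 * R ≤ ‖x‖ → ψ R x = 0) ∧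
      (∀ x, ‖fderiv ℝ (ψ R) x‖ ≤ C₀ / R) := by
  let f : ContDiffBump (0 : EuclideanSpace ℝ (Fin N)) := ⟨1, 2, by norm_num, by norm_num⟩
  have hf : ContDiff ℝ 1 f := f.contDiff
  obtain ⟨C, hC⟩ := (f.hasCompactSupport.fderiv ℝ).exists_bound_of_continuous
    (hf.continuous_fderiv one_ne_zero)
  have hC0 : 0 ≤ C := (norm_nonneg _).trans (hC 0)
  refine ⟨C + 1, by linarith, fun R x => f (R⁻¹ • x), fun R hR => ⟨?_, ?_, ?_, ?_, ?_, ?_⟩⟩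
  · exact hf.comp (contDiff_const_smul _)
  · exact fun x => f.nonneg
  · exact fun x => f.le_one
  · intro x hx
    apply f.one_of_mem_closedBall
    rw [mem_closedBall_zero_iff, norm_smul, norm_inv, Real.norm_of_nonneg hR.le]
    change _ ≤ (1:ℝ)
    rw [inv_mul_le_iff₀ hR]; linarith
  · intro x hx
    apply f.zero_of_le_dist
    rw [dist_zero_right, norm_smul, norm_inv, Real.norm_of_nonneg hR.le]
    change (2:ℝ) ≤ _
    rw [le_inv_mul_iff₀ hR]; linarith
  · intro x
    have h1 : HasFDerivAt (fun x : EuclideanSpace ℝ (Fin N) => R⁻¹ • x)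
      (R⁻¹ • ContinuousLinearMap.id ℝ _) x := (hasFDerivAt_id x).const_smul R⁻¹
    have h2 := ((hf.differentiable one_ne_zero (R⁻¹ • x)).hasFDerivAt).comp x h1
    have h3 : fderiv ℝ (fun x => f (R⁻¹ • x)) x = R⁻¹ • fderiv ℝ f (R⁻¹ • x) := by
      rw [show (fun x => f (R⁻¹ • x)) = f ∘ (fun x => R⁻¹ • x) from rfl, h2.fderiv]
      ext v; simp
    rw [h3, norm_smul, norm_inv, Real.norm_of_nonneg hR.le, div_eq_inv_mul]
    gcongr
    linarith [hC (R⁻¹ • x)]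

lemma flux_norm {E : Type*} [NormedAddCommGroup E] [NormedSpace ℝ E] {p : ℝ} (hp : 1 < p)
    (w : E) : ‖‖w‖ ^ (p - 2) • w‖ = ‖w‖ ^ (p - 1) := by
  rw [norm_smul, Real.norm_of_nonneg (by positivity)]
  by_cases hw : w = 0
  · simp [hw, Real.zero_rpow (by linarith : p - 1 ≠ 0)]
  · rw [← Real.rpow_add_one (norm_ne_zero_iff.2 hw)]; ring_nf

lemma flux_fderiv {N : ℕ} {p : ℝ} (hp : 1 < p) (u : EuclideanSpace ℝ (Fin N) → ℝ)
    (x : EuclideanSpace ℝ (Fin N)) :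
    fderiv ℝ u x (‖gradient u x‖ ^ (p - 2) • gradient u x) = ‖gradient u x‖ ^ p := by
  rw [← inner_gradient_left, real_inner_smul_right, real_inner_self_eq_norm_sq]
  by_cases hw : gradient u x = 0
  · simp [hw, Real.zero_rpow (by linarith : p ≠ 0)]
  · rw [← Real.rpow_add_natCast (norm_ne_zero_iff.2 hw)]; congr 1; push_cast; ring

/-- pointwise estimate of the tested flux -/
lemma flux_test_le {N : ℕ} {p q α lam : ℝ} {k : ℕ} (hp : 1 < p) (hα : 0 < α)
    (hlam : 0 < lam) (hmq : (1 + α) * (p - 1) ≤ q) (hk2 : 2 ≤ k)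
    (hk : p ≤ k * (1 - (1 + α) * (p - 1) / q))
    (u ψ : EuclideanSpace ℝ (Fin N) → ℝ) (hu : ContDiff ℝ 1 u) (hu0 : ∀ x, 0 ≤ u x)
    (hψ : ContDiff ℝ 1 ψ) (hψ0 : ∀ x, 0 ≤ ψ x) (hψ1 : ∀ x, ψ x ≤ 1)
    (x : EuclideanSpace ℝ (Fin N)) :
    fderiv ℝ (fun y => ψ y ^ k * (1 + (1 + u y / lam) ^ (-α))) x
      (‖gradient u x‖ ^ (p - 2) • gradient u x) ≤
    (2 * k) ^ p * α ^ (1 - p) * lam ^ (p - 1) * ‖fderiv ℝ ψ x‖ ^ p *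
      (2 * 2 ^ q * (1 + (u x / lam) ^ q * ψ x ^ k)) := by
  have hs : 1 ≤ 1 + u x / lam := by have := div_nonneg (hu0 x) hlam.le; linarith
  have du := (hu.differentiable one_ne_zero x).hasFDerivAt
  have dψ := (hψ.differentiable one_ne_zero x).hasFDerivAt
  have d1 := dψ.pow k
  have d2 : HasFDerivAt (fun y => 1 + (1 + u y / lam) ^ (-α))
      ((-α * (1 + u x / lam) ^ (-α - 1)) • (lam⁻¹ • fderiv ℝ u x)) x := by
    have d3 : HasFDerivAt (fun y => 1 + u y / lam) (lam⁻¹ • fderiv ℝ u x) x := by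
      simpa [div_eq_inv_mul] using (du.const_mul lam⁻¹).const_add 1
    exact (d3.rpow_const (p := -α) (Or.inl (by linarith))).const_add 1
  have d := d1.mul d2
  have e : fderiv ℝ (fun y => ψ y ^ k * (1 + (1 + u y / lam) ^ (-α))) x
      (‖gradient u x‖ ^ (p - 2) • gradient u x) =
      k * ψ x ^ (k - 1) * (1 + (1 + u x / lam) ^ (-α)) *
        fderiv ℝ ψ x (‖gradient u x‖ ^ (p - 2) • gradient u x)
      - α / lam * (1 + u x / lam) ^ (-α - 1) * ψ x ^ k * ‖gradient u x‖ ^ p := by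
    have := d.fderiv
    change fderiv ℝ (fun y => ψ y ^ k * (1 + (1 + u y / lam) ^ (-α))) x = _ at this
    rw [this, ← flux_fderiv hp]
    simp only [add_apply, smul_apply, smul_eq_mul, nsmul_eq_mul]
    ring
  rw [e]
  refine le_trans ?_ (pointwise_aux (G := ‖gradient u x‖) hp hα hlam (norm_nonneg _) (hψ0 x)
    (hψ1 x) (norm_nonneg (fderiv ℝ ψ x)) (hu0 x) hmq hk2 hk)
  gcongr ?_ - _
  have h1 : fderiv ℝ ψ x (‖gradient u x‖ ^ (p - 2) • gradient u x) ≤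
      ‖fderiv ℝ ψ x‖ * ‖gradient u x‖ ^ (p - 1) := by
    rw [← flux_norm hp]
    exact (Real.le_norm_self _).trans (ContinuousLinearMap.le_opNorm _ _)
  have h2 : (1 + u x / lam) ^ (-α) ≤ 1 :=
    Real.rpow_le_one_of_one_le_of_nonpos hs (by linarith)
  have h3 : 0 ≤ (1 + u x / lam) ^ (-α) := by positivity
  have h4 := hψ0 x
  calc _ ≤ k * ψ x ^ (k - 1) * (1 + (1 + u x / lam) ^ (-α)) *
        (‖fderiv ℝ ψ x‖ * ‖gradient u x‖ ^ (p - 1)) := by gcongr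
    _ ≤ k * ψ x ^ (k - 1) * (1 + 1) *
        (‖fderiv ℝ ψ x‖ * ‖gradient u x‖ ^ (p - 1)) := by gcongr
    _ = _ := by ring

/-- pointwise estimate localised in the annulus -/
lemma flux_test_indicator {N : ℕ} {p q α lam a γ R₀ R C₀ : ℝ} {k : ℕ} (hp : 1 < p) (hα : 0 < α)
    (hlam : 0 < lam) (hmq : (1 + α) * (p - 1) ≤ q) (hk2 : 2 ≤ k)
    (hk : p ≤ k * (1 - (1 + α) * (p - 1) / q))
    (ha : 0 < a) (hR₀ : 0 < R₀) (hR : R₀ ≤ R) (hC₀ : 0 < C₀)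
    (h u ψ : EuclideanSpace ℝ (Fin N) → ℝ)
    (hh_eq : ∀ x : EuclideanSpace ℝ (Fin N), R₀ ≤ ‖x‖ → h x = a * ‖x‖ ^ γ)
    (hu : ContDiff ℝ 1 u) (hu0 : ∀ x, 0 ≤ u x)
    (hψ : ContDiff ℝ 1 ψ) (hψ0 : ∀ x, 0 ≤ ψ x) (hψ1 : ∀ x, ψ x ≤ 1)
    (hψR : ∀ x, ‖x‖ ≤ R → ψ x = 1) (hψ2R : ∀ x, 2 * R ≤ ‖x‖ → ψ x = 0)
    (hψC : ∀ x, ‖fderiv ℝ ψ x‖ ≤ C₀ / R)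
    (x : EuclideanSpace ℝ (Fin N)) :
    fderiv ℝ (fun y => ψ y ^ k * (1 + (1 + u y / lam) ^ (-α))) x
      (‖gradient u x‖ ^ (p - 2) • gradient u x) ≤
    (ball (0 : EuclideanSpace ℝ (Fin N)) (2 * R) \ ball 0 R).indicator
      (fun x => ((2 * k) ^ p * α ^ (1 - p) * C₀ ^ p * (2 * 2 ^ q)) * (lam ^ (p - 1) * R ^ (-p)) *
        (1 + lam ^ (-q) * (2 ^ |γ| * a⁻¹ * R ^ (-γ)) * (h x * u x ^ q * ψ x ^ k))) x := by
  have hR' : 0 < R := by linarith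
  refine (flux_test_le hp hα hlam hmq hk2 hk u ψ hu hu0 hψ hψ0 hψ1 x).trans ?_
  by_cases hx : x ∈ ball (0 : EuclideanSpace ℝ (Fin N)) (2 * R) \ ball 0 R
  · rw [Set.indicator_of_mem hx]
    simp only [Set.mem_sdiff, mem_ball_zero_iff, not_lt] at hx
    have hx0 : 0 < ‖x‖ := by linarith
    have h1 : ‖fderiv ℝ ψ x‖ ^ p ≤ C₀ ^ p * R ^ (-p) := by
      rw [Real.rpow_neg hR'.le, ← div_eq_mul_inv, ← Real.div_rpow hC₀.le hR'.le]
      exact Real.rpow_le_rpow (norm_nonneg _) (hψC x) (by linarith)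
    have h2 : u x ^ q ≤ 2 ^ |γ| * a⁻¹ * R ^ (-γ) * (h x * u x ^ q) := by
      have hu' : 0 ≤ u x ^ q := Real.rpow_nonneg (hu0 x) _
      have h3 : 1 ≤ 2 ^ |γ| * (‖x‖ / R) ^ γ := by
        have e1 : 1 ≤ ‖x‖ / R := by rw [le_div_iff₀ hR']; linarith
        have e2 : ‖x‖ / R ≤ 2 := by rw [div_le_iff₀ hR']; linarith
        have e0 : 0 < ‖x‖ / R := by linarith
        have e3 : (‖x‖ / R) ^ (-γ) ≤ 2 ^ |γ| :=
          (Real.rpow_le_rpow_of_exponent_le e1 (neg_le_abs γ)).trans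
            (Real.rpow_le_rpow e0.le e2 (abs_nonneg _))
        have e4 : (‖x‖ / R) ^ (-γ) * (‖x‖ / R) ^ γ = 1 := by
          rw [← Real.rpow_add e0]; simp
        rw [← e4]
        gcongr
      rw [hh_eq x (by linarith)]
      calc u x ^ q = 1 * u x ^ q := by ring
        _ ≤ 2 ^ |γ| * (‖x‖ / R) ^ γ * u x ^ q := by gcongr
        _ = _ := by
          rw [Real.div_rpow hx0.le hR'.le, Real.rpow_neg hR'.le]
          field_simp
    have h4 : (u x / lam) ^ q * ψ x ^ k ≤
        lam ^ (-q) * (2 ^ |γ| * a⁻¹ * R ^ (-γ)) * (h x * u x ^ q * ψ x ^ k) := by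
      have := pow_nonneg (hψ0 x) k
      rw [Real.div_rpow (hu0 x) hlam.le, Real.rpow_neg hlam.le]
      calc _ = (lam ^ q)⁻¹ * u x ^ q * ψ x ^ k := by ring
        _ ≤ (lam ^ q)⁻¹ * (2 ^ |γ| * a⁻¹ * R ^ (-γ) * (h x * u x ^ q)) * ψ x ^ k := by gcongr
        _ = _ := by ring
    have h5 : 0 ≤ (u x / lam) ^ q * ψ x ^ k :=
      mul_nonneg (Real.rpow_nonneg (div_nonneg (hu0 x) hlam.le) _) (pow_nonneg (hψ0 x) k)
    calc _ ≤ (2 * k) ^ p * α ^ (1 - p) * lam ^ (p - 1) * (C₀ ^ p * R ^ (-p)) *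
          (2 * 2 ^ q * (1 +
            lam ^ (-q) * (2 ^ |γ| * a⁻¹ * R ^ (-γ)) * (h x * u x ^ q * ψ x ^ k))) := by gcongr
      _ = _ := by ring
  · rw [Set.indicator_of_notMem hx]
    have hD : fderiv ℝ ψ x = 0 := by
      simp only [Set.mem_sdiff, mem_ball_zero_iff, not_lt, not_and_or, not_le] at hx
      rcases hx with hx | hx
      · apply IsLocalMin.fderiv_eq_zero
        exact Filter.Eventually.of_forall fun y => by rw [hψ2R x hx]; exact hψ0 y
      · apply IsLocalMax.fderiv_eq_zero
        exact Filter.Eventually.of_forall fun y => by rw [hψR x hx.le]; exact hψ1 y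
    rw [hD, norm_zero, Real.zero_rpow (by linarith)]
    simp

lemma cpt_supp_of_zero {N : ℕ} {M : ℝ} (f : EuclideanSpace ℝ (Fin N) → ℝ)
    (hf : ∀ x, M ≤ ‖x‖ → f x = 0) : HasCompactSupport f :=
  HasCompactSupport.intro (isCompact_closedBall 0 M) fun x hx => hf x (by
    simp at hx; exact hx.le)

lemma test_contDiff {N : ℕ} {α lam : ℝ} {k : ℕ} (hlam : 0 < lam)
    (u ψ : EuclideanSpace ℝ (Fin N) → ℝ)
    (hu : ContDiff ℝ 1 u) (hu0 : ∀ x, 0 ≤ u x) (hψ : ContDiff ℝ 1 ψ) :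
    ContDiff ℝ 1 (fun y => ψ y ^ k * (1 + (1 + u y / lam) ^ (-α))) := by
  refine (hψ.pow k).mul (contDiff_const.add ?_)
  refine (contDiff_const.add (hu.div_const _)).rpow_const_of_ne fun x => ?_
  have := div_nonneg (hu0 x) hlam.le
  linarith

/-- integrated estimate -/
lemma energy {N : ℕ} {p q α lam a γ R₀ R C₀ : ℝ} {k : ℕ} (hp : 1 < p) (hα : 0 < α)
    (hlam : 0 < lam) (hmq : (1 + α) * (p - 1) ≤ q) (hk2 : 2 ≤ k)
    (hk : p ≤ k * (1 - (1 + α) * (p - 1) / q))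
    (ha : 0 < a) (hR₀ : 0 < R₀) (hR : R₀ ≤ R) (hC₀ : 0 < C₀)
    (h u ψ : EuclideanSpace ℝ (Fin N) → ℝ)
    (hh_nonneg : ∀ x, 0 ≤ h x)
    (hh_eq : ∀ x : EuclideanSpace ℝ (Fin N), R₀ ≤ ‖x‖ → h x = a * ‖x‖ ^ γ)
    (hu : ContDiff ℝ 1 u) (hu0 : ∀ x, 0 ≤ u x) (hgc : Continuous fun x => h x * u x ^ q)
    (hFc : Continuous fun x => ‖gradient u x‖ ^ (p - 2) • gradient u x)
    (hψ : ContDiff ℝ 1 ψ) (hψ0 : ∀ x, 0 ≤ ψ x) (hψ1 : ∀ x, ψ x ≤ 1)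
    (hψR : ∀ x, ‖x‖ ≤ R → ψ x = 1) (hψ2R : ∀ x, 2 * R ≤ ‖x‖ → ψ x = 0)
    (hψC : ∀ x, ‖fderiv ℝ ψ x‖ ≤ C₀ / R)
    (hw : ∀ φ : EuclideanSpace ℝ (Fin N) → ℝ,
      ContDiff ℝ 1 φ → HasCompactSupport φ → (∀ x, 0 ≤ φ x) →
      ∫ x, h x * u x ^ q * φ x ≤
        ∫ x, fderiv ℝ φ x (‖gradient u x‖ ^ (p - 2) • gradient u x)) :
    ∫ x, h x * u x ^ q * ψ x ^ k ≤
      ((2 * k) ^ p * α ^ (1 - p) * C₀ ^ p * (2 * 2 ^ q)) * (lam ^ (p - 1) * R ^ (-p)) *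
        (2 ^ N * R ^ N * volume.real (ball (0 : EuclideanSpace ℝ (Fin N)) 1)
          + lam ^ (-q) * (2 ^ |γ| * a⁻¹ * R ^ (-γ)) *
        ∫ x in ball (0 : EuclideanSpace ℝ (Fin N)) (2 * R) \ ball 0 R,
          h x * u x ^ q * ψ x ^ k) := by
  have hR' : 0 < R := by linarith
  set φ := fun y => ψ y ^ k * (1 + (1 + u y / lam) ^ (-α)) with hφdef
  have hs0 : ∀ x, 0 ≤ (1 + u x / lam) ^ (-α) := fun x => by
    have := div_nonneg (hu0 x) hlam.le
    positivity
  have hφ : ContDiff ℝ 1 φ := test_contDiff hlam u ψ hu hu0 hψ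
  have hφz : ∀ x, 2 * R ≤ ‖x‖ → φ x = 0 := fun x hx => by
    simp only [hφdef, hψ2R x hx, zero_pow (by omega : k ≠ 0), zero_mul]
  have hφc : HasCompactSupport φ := cpt_supp_of_zero φ hφz
  have hφ0 : ∀ x, 0 ≤ φ x := fun x =>
    mul_nonneg (pow_nonneg (hψ0 x) k) (by linarith [hs0 x])
  have hψkc : HasCompactSupport (fun x => ψ x ^ k) := cpt_supp_of_zero (M := 2 * R) _ fun x hx => by
    simp [hψ2R x hx, zero_pow (by omega : k ≠ 0)]
  have hgψc : Continuous fun x => h x * u x ^ q * ψ x ^ k := hgc.mul (hψ.continuous.pow k)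
  have hgψi : Integrable fun x => h x * u x ^ q * ψ x ^ k :=
    hgψc.integrable_of_hasCompactSupport hψkc.mul_left
  have s1 : ∫ x, h x * u x ^ q * ψ x ^ k ≤ ∫ x, h x * u x ^ q * φ x := by
    refine integral_mono hgψi
      ((hgc.mul hφ.continuous).integrable_of_hasCompactSupport hφc.mul_left) fun x => ?_
    have h1 : 0 ≤ h x * u x ^ q := mul_nonneg (hh_nonneg x) (Real.rpow_nonneg (hu0 x) _)
    have h2 := pow_nonneg (hψ0 x) k
    have h3 := hs0 x
    simp only [hφdef]
    apply mul_le_mul_of_nonneg_left _ h1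
    nlinarith
  have hA : MeasurableSet (ball (0 : EuclideanSpace ℝ (Fin N)) (2 * R) \ ball 0 R) :=
    measurableSet_ball.diff measurableSet_ball
  have hAfin : volume (ball (0 : EuclideanSpace ℝ (Fin N)) (2 * R) \ ball 0 R) ≠ ⊤ :=
    ((measure_mono Set.sdiff_subset).trans_lt measure_ball_lt_top).ne
  have i1 : IntegrableOn (fun _ => (1:ℝ))
      (ball (0 : EuclideanSpace ℝ (Fin N)) (2 * R) \ ball 0 R) := integrableOn_const hAfin
  have i2 := (hgψi.integrableOn (s := ball (0 : EuclideanSpace ℝ (Fin N)) (2 * R) \ ball 0 R)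
    ).const_mul (lam ^ (-q) * (2 ^ |γ| * a⁻¹ * R ^ (-γ)))
  have i3 := (i1.add i2).const_mul
    (((2 * k) ^ p * α ^ (1 - p) * C₀ ^ p * (2 * 2 ^ q)) * (lam ^ (p - 1) * R ^ (-p)))
  have i4 : Integrable (fun x => fderiv ℝ φ x (‖gradient u x‖ ^ (p - 2) • gradient u x)) := by
    refine ((hφ.continuous_fderiv one_ne_zero).clm_apply hFc).integrable_of_hasCompactSupport ?_
    refine (hφc.fderiv ℝ).mono ?_
    intro x hx hx'
    apply hx
    simp only [hx', zero_apply]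
  have s2 := integral_mono i4 ((integrable_indicator_iff hA).2 i3) (fun x =>
    flux_test_indicator hp hα hlam hmq hk2 hk ha hR₀ hR hC₀ h u ψ hh_eq hu hu0 hψ hψ0 hψ1
      hψR hψ2R hψC x)
  rw [integral_indicator hA, integral_const_mul] at s2
  have s3 := integral_add i1 i2
  simp only [Pi.add_apply] at s2
  rw [s3, integral_const_mul, setIntegral_const, smul_eq_mul, mul_one] at s2
  refine s1.trans ((hw φ hφ hφc hφ0).trans (s2.trans ?_))
  have hvol : volume.real (ball (0 : EuclideanSpace ℝ (Fin N)) (2 * R) \ ball 0 R) ≤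
      2 ^ N * R ^ N * volume.real (ball (0 : EuclideanSpace ℝ (Fin N)) 1) := by
    refine (measureReal_mono Set.sdiff_subset measure_ball_lt_top.ne).trans (le_of_eq ?_)
    rw [measureReal_def, Measure.addHaar_ball_of_pos _ _ (by positivity), ENNReal.toReal_mul,
      ENNReal.toReal_ofReal (by positivity), finrank_euclideanSpace_fin, mul_pow, measureReal_def]
  gcongr

lemma gradient_continuous {N : ℕ} {u : EuclideanSpace ℝ (Fin N) → ℝ} (hu : ContDiff ℝ 1 u) :
    Continuous (gradient u) := by
  unfold gradient
  exact (LinearIsometryEquiv.continuous _).comp (hu.continuous_fderiv one_ne_zero)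

/-- exponent bookkeeping -/
lemma scaling {N : ℕ} {p q γ R K : ℝ} (hp : 1 < p) (hpN : p < N) (hq₁ : p - 1 < q)
    (hq₂ : q ≤ ((N : ℝ) + γ) * (p - 1) / ((N : ℝ) - p)) (hR : 1 ≤ R) (hK : 0 < K) :
    (K * R ^ (-((N + γ) / q))) ^ (p - 1) * R ^ (-p) * R ^ N ≤ K ^ (p - 1) ∧
    (K * R ^ (-((N + γ) / q))) ^ (p - 1) * R ^ (-p) *
      ((K * R ^ (-((N + γ) / q))) ^ (-q) * R ^ (-γ)) ≤ K ^ (p - 1 - q) := by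
  have hR0 : 0 < R := by linarith
  have hq : 0 < q := by linarith
  have hσ : (N:ℝ) - p - (N + γ) / q * (p - 1) ≤ 0 := by
    rw [le_div_iff₀ (by linarith)] at hq₂
    have : (N + γ) / q * (p - 1) = ((N + γ) * (p - 1)) / q := by ring
    rw [this, sub_nonpos, le_div_iff₀ hq]
    linarith
  have hR1 : R ^ ((N:ℝ) - p - (N + γ) / q * (p - 1)) ≤ 1 :=
    Real.rpow_le_one_of_one_le_of_nonpos hR hσ
  have hqq : (N + γ) / q * q = N + γ := div_mul_cancel₀ _ hq.ne'
  constructor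
  · rw [Real.mul_rpow hK.le (by positivity), ← Real.rpow_mul hR0.le, ← Real.rpow_natCast R N,
      mul_assoc, mul_assoc, ← Real.rpow_add hR0, ← Real.rpow_add hR0]
    have e : -((N + γ) / q) * (p - 1) + (-p + N) = (N:ℝ) - p - (N + γ) / q * (p - 1) := by ring
    rw [e]
    exact mul_le_of_le_one_right (by positivity) hR1
  · rw [Real.mul_rpow hK.le (by positivity), Real.mul_rpow hK.le (by positivity),
      ← Real.rpow_mul hR0.le, ← Real.rpow_mul hR0.le]
    have e : K ^ (p - 1) * R ^ (-((N + γ) / q) * (p - 1)) * R ^ (-p) *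
        (K ^ (-q) * R ^ (-((N + γ) / q) * -q) * R ^ (-γ)) =
        K ^ (p - 1 - q) * R ^ ((N:ℝ) - p - (N + γ) / q * (p - 1)) := by
      rw [sub_eq_add_neg (p - 1) q, Real.rpow_add hK]
      have : (N:ℝ) - p - (N + γ) / q * (p - 1) =
        -((N + γ) / q) * (p - 1) + -p + -((N + γ) / q) * -q + -γ := by
        linear_combination -hqq
      rw [this, Real.rpow_add hR0, Real.rpow_add hR0, Real.rpow_add hR0]
      ring
    rw [e]
    exact mul_le_of_le_one_right (by positivity) hR1

/-- a compactly supported nonnegative `p`-supersolution vanishes -/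
lemma zero_of_zero_outside {N : ℕ} {p R₀ : ℝ} (hp : 1 < p) (hN : 0 < N) (hR₀ : 0 < R₀)
    (u g : EuclideanSpace ℝ (Fin N) → ℝ) (hu : ContDiff ℝ 1 u) (hu0 : ∀ x, 0 ≤ u x)
    (hg0 : ∀ x, 0 ≤ g x)
    (hw : ∀ φ : EuclideanSpace ℝ (Fin N) → ℝ,
      ContDiff ℝ 1 φ → HasCompactSupport φ → (∀ x, 0 ≤ φ x) →
      ∫ x, g x * φ x ≤
        ∫ x, fderiv ℝ φ x (‖gradient u x‖ ^ (p - 2) • gradient u x))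
    (hz : ∀ x, R₀ ≤ ‖x‖ → u x = 0) : ∀ x, u x = 0 := by
  obtain ⟨C₀, -, ψ', hψ'⟩ := cutoff_exists N
  obtain ⟨hψ, hψ0, hψ1, hψR, hψ2R, -⟩ := hψ' R₀ hR₀
  set ψ := ψ' R₀
  obtain ⟨M, hM⟩ := (cpt_supp_of_zero u hz).exists_bound_of_continuous hu.continuous
  have hM' : ∀ x, u x ≤ M := fun x => (Real.le_norm_self _).trans (hM x)
  have hgz : ∀ x, R₀ ≤ ‖x‖ → gradient u x = 0 := by
    intro x hx
    have : fderiv ℝ u x = 0 := by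
      apply IsLocalMin.fderiv_eq_zero
      exact Filter.Eventually.of_forall fun y => by rw [hz x hx]; exact hu0 y
    rw [gradient, this, map_zero]
  have key := hw (fun x => (M - u x) * ψ x) ((contDiff_const.sub hu).mul hψ)
    (cpt_supp_of_zero (M := 2 * R₀) _ fun x hx => by simp [hψ2R x hx])
    (fun x => mul_nonneg (by linarith [hM' x]) (hψ0 x))
  have hpos : 0 ≤ ∫ x, g x * ((M - u x) * ψ x) := integral_nonneg fun x =>
    mul_nonneg (hg0 x) (mul_nonneg (by linarith [hM' x]) (hψ0 x))
  have hF : ∀ x, fderiv ℝ (fun x => (M - u x) * ψ x) x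
      (‖gradient u x‖ ^ (p - 2) • gradient u x) = -‖gradient u x‖ ^ p := by
    intro x
    rcases le_or_gt R₀ ‖x‖ with hx | hx
    · rw [hgz x hx, smul_zero, map_zero, norm_zero, Real.zero_rpow (by linarith), neg_zero]
    · have hD : fderiv ℝ ψ x = 0 := by
        apply IsLocalMax.fderiv_eq_zero
        exact Filter.Eventually.of_forall fun y => by rw [hψR x hx.le]; exact hψ1 y
      have du := ((hu.differentiable one_ne_zero x).hasFDerivAt).const_sub M
      have dψ := (hψ.differentiable one_ne_zero x).hasFDerivAt
      have d := (du.mul dψ).fderiv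
      change fderiv ℝ (fun x => (M - u x) * ψ x) x = _ at d
      rw [d, hD, hψR x hx.le, ← flux_fderiv hp]
      simp
  simp only [hF, integral_neg] at key
  have hGc : Continuous (fun x => ‖gradient u x‖ ^ p) :=
    (gradient_continuous hu).norm.rpow_const fun _ => Or.inr (by linarith)
  have hGs : HasCompactSupport (fun x => ‖gradient u x‖ ^ p) :=
    cpt_supp_of_zero (M := R₀) _ fun x hx => by
      rw [hgz x hx, norm_zero, Real.zero_rpow (by linarith)]
  have hG0 : ∫ x, ‖gradient u x‖ ^ p = 0 :=
    le_antisymm (by linarith) (integral_nonneg fun x => by positivity)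
  rw [integral_eq_zero_iff_of_nonneg (fun x => by positivity)
    (hGc.integrable_of_hasCompactSupport hGs)] at hG0
  have hG := hGc.ae_eq_iff_eq volume continuous_zero |>.1 hG0
  have hfd : ∀ x, fderiv ℝ u x = 0 := by
    intro x
    have h1 := congrFun hG x
    simp only [Pi.zero_apply] at h1
    rw [Real.rpow_eq_zero (norm_nonneg _) (by linarith), norm_eq_zero] at h1
    rw [← toDual_gradient, h1, map_zero]
  intro x
  rw [is_const_of_fderiv_eq_zero (hu.differentiable one_ne_zero) hfd x
    (EuclideanSpace.single (⟨0, hN⟩ : Fin N) R₀)]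
  apply hz
  simp [abs_of_pos hR₀]

/-- Liouville theorem: for `N > p > 1`, `h(x) = a|x|^γ` at infinity with `γ > -p`, and
`p - 1 < q ≤ (N+γ)(p-1)/(N-p)`, any nonnegative weak solution of `-Δ_p u ≥ h u^q`
in `ℝ^N` vanishes identically. -/
theorem liouville_p_laplacian_supersolution
    (N : ℕ) (p a γ q R₀ : ℝ) (hp : 1 < p) (hpN : p < N)
    (ha : 0 < a) (hγ : -p < γ) (hR₀ : 0 < R₀)
    (h : EuclideanSpace ℝ (Fin N) → ℝ)
    (hh_cont : Continuous h) (hh_nonneg : ∀ x, 0 ≤ h x)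
    (hh_eq : ∀ x : EuclideanSpace ℝ (Fin N), R₀ ≤ ‖x‖ → h x = a * ‖x‖ ^ γ)
    (hq₁ : p - 1 < q) (hq₂ : q ≤ ((N : ℝ) + γ) * (p - 1) / ((N : ℝ) - p))
    (u : EuclideanSpace ℝ (Fin N) → ℝ)
    (hu : ContDiff ℝ 1 u) (hu_nonneg : ∀ x, 0 ≤ u x)
    (hweak : ∀ φ : EuclideanSpace ℝ (Fin N) → ℝ,
      ContDiff ℝ (⊤ : ℕ∞) φ → HasCompactSupport φ → (∀ x, 0 ≤ φ x) →
      ∫ x, h x * u x ^ q * φ x ≤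
        ∫ x, ‖gradient u x‖ ^ (p - 2) * ⟪gradient u x, gradient φ x⟫) :
    ∀ x, u x = 0 := by
  have hq : 0 < q := by linarith
  have hNpos : 0 < N := by
    have : (0:ℝ) < N := by linarith
    exact_mod_cast this
  set g : EuclideanSpace ℝ (Fin N) → ℝ := fun x => h x * u x ^ q with hgdef
  have hgc : Continuous g :=
    hh_cont.mul (hu.continuous.rpow_const fun _ => Or.inr hq.le)
  have hg0 : ∀ x, 0 ≤ g x := fun x => mul_nonneg (hh_nonneg x) (Real.rpow_nonneg (hu_nonneg x) _)
  have hFc : Continuous fun x => ‖gradient u x‖ ^ (p - 2) • gradient u x :=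
    (flux_cont hp).comp (gradient_continuous hu)
  have hw := weak_C1 (fun x => ‖gradient u x‖ ^ (p - 2) • gradient u x) g hFc hgc (by
    intro φ h1 h2 h3
    refine (hweak φ h1 h2 h3).trans (le_of_eq ?_)
    congr 1
    ext x
    rw [← inner_gradient_left, real_inner_smul_right, real_inner_comm])
  refine zero_of_zero_outside hp hNpos hR₀ u g hu hu_nonneg hg0 hw ?_
  -- choice of parameters
  obtain ⟨α, hα, hαq⟩ : ∃ α : ℝ, 0 < α ∧ (1 + α) * (p - 1) < q := by
    refine ⟨(q - (p - 1)) / (2 * (p - 1)), div_pos (by linarith) (by linarith), ?_⟩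
    have hp1 : p - 1 ≠ 0 := by linarith
    have : (1 + (q - (p - 1)) / (2 * (p - 1))) * (p - 1) = (q + (p - 1)) / 2 := by
      field_simp; ring
    rw [this]; linarith
  have hpos : 0 < 1 - (1 + α) * (p - 1) / q := by
    rw [sub_pos, div_lt_one hq]; exact hαq
  obtain ⟨k₀, hk₀⟩ := exists_nat_ge (p / (1 - (1 + α) * (p - 1) / q))
  obtain ⟨k, hk2, hk⟩ : ∃ k : ℕ, 2 ≤ k ∧ p ≤ k * (1 - (1 + α) * (p - 1) / q) := by
    refine ⟨max 2 k₀, le_max_left _ _, ?_⟩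
    rw [← div_le_iff₀ hpos]
    refine hk₀.trans ?_
    exact_mod_cast le_max_right _ _
  obtain ⟨C₀, hC₀, ψ, hψ⟩ := cutoff_exists N
  have hgi : ∀ R, IntegrableOn g (ball (0 : EuclideanSpace ℝ (Fin N)) R) := fun R =>
    (hgc.continuousOn.integrableOn_compact (isCompact_closedBall 0 R)).mono_set
      ball_subset_closedBall
  set C₁ := (2 * (k:ℝ)) ^ p * α ^ (1 - p) * C₀ ^ p * (2 * 2 ^ q) with hC₁
  set V := (2:ℝ) ^ N * volume.real (ball (0 : EuclideanSpace ℝ (Fin N)) 1) with hV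
  set C₂ := (2:ℝ) ^ |γ| * a⁻¹ with hC₂
  have hkpos : (0:ℝ) < k := by exact_mod_cast (by omega : 0 < k)
  have hC₁0 : 0 < C₁ := by positivity
  have hC₂0 : 0 < C₂ := by positivity
  have hV0 : 0 ≤ V := by positivity
  have hψi : ∀ R, 0 < R → Integrable (fun x => g x * ψ R x ^ k) := by
    intro R hR
    obtain ⟨h1, -, -, -, h5, -⟩ := hψ R hR
    refine (hgc.mul (h1.continuous.pow k)).integrable_of_hasCompactSupport ?_
    exact cpt_supp_of_zero (M := 2 * R) _ fun x hx => by
      simp [h5 x hx, zero_pow (by omega : k ≠ 0)]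
  have hψn : ∀ R, 0 < R → ∀ x, 0 ≤ g x * ψ R x ^ k := fun R hR x =>
    mul_nonneg (hg0 x) (pow_nonneg ((hψ R hR).2.1 x) k)
  have hlim := limit_aux (p := p) (q := q) (C := C₁ * (V + C₂)) (R₁ := max R₀ 1) hp hq₁
    (by positivity)
    (fun R => ∫ x in ball (0 : EuclideanSpace ℝ (Fin N)) R, g x)
    (fun R => ∫ x, g x * ψ R x ^ k)
    (fun R => ∫ x in ball (0 : EuclideanSpace ℝ (Fin N)) (2 * R) \ ball 0 R, g x * ψ R x ^ k)
    (by
      intro R R' hRR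
      exact setIntegral_mono_set (hgi R') (Filter.Eventually.of_forall hg0)
        (ball_subset_ball hRR).eventuallyLE)
    (by
      intro R hR
      have hR0 : 0 < R := hR₀.trans_le ((le_max_left _ _).trans hR)
      have e : ∫ x in ball (0 : EuclideanSpace ℝ (Fin N)) R, g x =
          ∫ x in ball (0 : EuclideanSpace ℝ (Fin N)) R, g x * ψ R x ^ k := by
        refine setIntegral_congr_fun measurableSet_ball fun x hx => ?_
        rw [mem_ball_zero_iff] at hx
        simp [(hψ R hR0).2.2.2.1 x hx.le]
      change (∫ x in ball (0 : EuclideanSpace ℝ (Fin N)) R, g x) ≤ _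
      rw [e]
      exact setIntegral_le_integral (hψi R hR0) (Filter.Eventually.of_forall (hψn R hR0)))
    (by
      intro R hR
      have hR0 : 0 < R := hR₀.trans_le ((le_max_left _ _).trans hR)
      exact setIntegral_le_integral (hψi R hR0) (Filter.Eventually.of_forall (hψn R hR0)))
    (by
      intro R hR
      have hR0 : 0 < R := hR₀.trans_le ((le_max_left _ _).trans hR)
      have e := setIntegral_sdiff measurableSet_ball (hgi (2 * R))
        (ball_subset_ball (by linarith : R ≤ 2 * R))
      change _ ≤ (∫ x in ball (0 : EuclideanSpace ℝ (Fin N)) (2 * R), g x) -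
        (∫ x in ball (0 : EuclideanSpace ℝ (Fin N)) R, g x)
      rw [← e]
      refine setIntegral_mono (hψi R hR0).integrableOn
        ((hgi (2 * R)).mono_set Set.sdiff_subset) fun x => ?_
      exact mul_le_of_le_one_right (hg0 x)
        (pow_le_one₀ ((hψ R hR0).2.1 x) ((hψ R hR0).2.2.1 x)))
    (by
      intro R hR K hK
      have hRR₀ : R₀ ≤ R := (le_max_left _ _).trans hR
      have hR1 : 1 ≤ R := (le_max_right _ _).trans hR
      have hR0 : 0 < R := by linarith
      obtain ⟨h1, h2, h3, h4, h5, h6⟩ := hψ R hR0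
      have hlam : 0 < K * R ^ (-((N + γ) / q)) := by positivity
      have en := energy (lam := K * R ^ (-((N + γ) / q))) hp hα hlam hαq.le hk2 hk ha hR₀ hRR₀
        hC₀ h u (ψ R) hh_nonneg hh_eq hu hu_nonneg hgc hFc h1 h2 h3 h4 h5 h6 hw
      refine en.trans ?_
      obtain ⟨sc1, sc2⟩ := scaling hp hpN hq₁ hq₂ hR1 hK
      change _ ≤ C₁ * (V + C₂) * (K ^ (p - 1) + K ^ (p - 1 - q) *
        ∫ x in ball (0 : EuclideanSpace ℝ (Fin N)) (2 * R) \ ball 0 R, g x * ψ R x ^ k)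
      have hI : 0 ≤ ∫ x in ball (0 : EuclideanSpace ℝ (Fin N)) (2 * R) \ ball 0 R,
          g x * ψ R x ^ k := integral_nonneg (hψn R hR0)
      set I := ∫ x in ball (0 : EuclideanSpace ℝ (Fin N)) (2 * R) \ ball 0 R, g x * ψ R x ^ k
      set lam := K * R ^ (-((N + γ) / q))
      have hK1 : 0 < K ^ (p - 1) := by positivity
      have hK2 : 0 < K ^ (p - 1 - q) := by positivity
      calc _ = C₁ * (V * (lam ^ (p - 1) * R ^ (-p) * R ^ N) +
            C₂ * (lam ^ (p - 1) * R ^ (-p) * (lam ^ (-q) * R ^ (-γ))) * I) := by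
              rw [hV]; ring
        _ ≤ C₁ * (V * K ^ (p - 1) + C₂ * K ^ (p - 1 - q) * I) := by gcongr
        _ ≤ C₁ * (V + C₂) * (K ^ (p - 1) + K ^ (p - 1 - q) * I) := by
          have t1 : 0 ≤ C₂ * K ^ (p - 1) := by positivity
          have t2 : 0 ≤ V * (K ^ (p - 1 - q) * I) := by positivity
          refine (mul_le_mul_of_nonneg_left ?_ hC₁0.le).trans_eq (mul_assoc C₁ _ _).symm
          nlinarith)
  intro x hx
  have hx1 : x ∈ ball (0 : EuclideanSpace ℝ (Fin N)) (‖x‖ + 1) := by simp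
  have hz : ∫ y in ball (0 : EuclideanSpace ℝ (Fin N)) (‖x‖ + 1), g y = 0 :=
    le_antisymm (hlim _) (integral_nonneg hg0)
  rw [setIntegral_eq_zero_iff_of_nonneg_ae (Filter.Eventually.of_forall hg0) (hgi _)] at hz
  have hgx := Measure.eqOn_open_of_ae_eq hz isOpen_ball hgc.continuousOn
    continuousOn_const hx1
  have hhx : h x ≠ 0 := by
    rw [hh_eq x hx]
    have : 0 < ‖x‖ := by linarith
    positivity
  have : h x * u x ^ q = 0 := hgx
  rcases mul_eq_zero.1 this with h0 | h0
  · exact absurd h0 hhx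
  · exact (Real.rpow_eq_zero (hu_nonneg x) hq.ne').1 h0
end
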